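/- Let w ∈ C^α(D̄;ℂⁿ), 0 < α < 1, satisfy the equation w = T(B₁w + B₂w̄) + φ on D with B₁, B₂ ∈ C^{k-1,α}(D) matrix functions and φ holomorphic on D. If w ∈ C^{k,α} on the annulus D \ D_{1/2}, then φ extends to C^{k,α}(D̄) and consequently w ∈ C^{k,α}(D̄;ℂⁿ). -/

import Mathlib

open Complex MeasureTheory Real Matrix

/-- The open unit disc in `ℂ`. -/
def unitDisc : Set ℂ := Metric.ball (0 : ℂ) 1

/-- The Cauchy–Green operator `Tu(ζ) = -(1/π) ∫_D u(ω)/(ω-ζ) dm(ω)`. -/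
noncomputable def cauchyGreen (u : ℂ → ℂ) (ζ : ℂ) : ℂ :=
  -(π : ℂ)⁻¹ * ∫ ω in unitDisc, u ω / (ω - ζ)

/-- Componentwise Cauchy–Green operator for `ℂⁿ`-valued functions. -/
noncomputable def cauchyGreenV {n : ℕ} (u : ℂ → (Fin n → ℂ)) (ζ : ℂ) : Fin n → ℂ :=
  fun j => cauchyGreen (fun ω => u ω j) ζ

/-- Componentwise complex conjugate of a vector in `ℂⁿ`. -/
def vecConj {n : ℕ} (u : Fin n → ℂ) : Fin n → ℂ := fun j => (starRingEnd ℂ) (u j)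

/-- Membership in the Hölder space `C^{k,α}(s)`. -/
def HolderOn {E : Type*} [NormedAddCommGroup E] [NormedSpace ℝ E]
    (k : ℕ) (α : ℝ) (s : Set ℂ) (f : ℂ → E) : Prop :=
  ContDiffOn ℝ k f s ∧ ∃ C > 0, ∀ x ∈ s, ∀ y ∈ s,
    ‖iteratedFDerivWithin ℝ k f s x - iteratedFDerivWithin ℝ k f s y‖ ≤ C * ‖x - y‖ ^ α

section Part1

section HolderAPI
variable {E F : Type*} [NormedAddCommGroup E] [NormedSpace ℝ E]
  [NormedAddCommGroup F] [NormedSpace ℝ F]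

theorem holder_zero_iff {α : ℝ} {s : Set ℂ} {f : ℂ → E} :
    HolderOn 0 α s f ↔ ContinuousOn f s ∧ ∃ C > 0, ∀ x ∈ s, ∀ y ∈ s,
      ‖f x - f y‖ ≤ C * ‖x - y‖ ^ α := by
  unfold HolderOn
  simp only [iteratedFDerivWithin_zero_eq_comp, Function.comp_apply, ← map_sub,
    LinearIsometryEquiv.norm_map, Nat.cast_zero, contDiffOn_zero]

theorem holder_succ_iff {m : ℕ} {α : ℝ} {s : Set ℂ} {f : ℂ → E} (hs : UniqueDiffOn ℝ s) :
    HolderOn (m + 1) α s f ↔ DifferentiableOn ℝ f s ∧ HolderOn m α s (fderivWithin ℝ f s) := by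
  unfold HolderOn
  have h1 : ContDiffOn ℝ ((m + 1 : ℕ) : WithTop ℕ∞) f s ↔
      DifferentiableOn ℝ f s ∧ ContDiffOn ℝ m (fderivWithin ℝ f s) s := by
    have := contDiffOn_succ_iff_fderivWithin (𝕜 := ℝ) (f := f) (n := (m : WithTop ℕ∞)) hs
    push_cast
    rw [this]
    simp
  rw [h1, and_assoc]
  refine and_congr_right fun _ => and_congr_right fun _ => ?_
  refine exists_congr fun C => and_congr_right fun _ => ?_
  refine forall₂_congr fun x hx => forall₂_congr fun y hy => ?_
  rw [iteratedFDerivWithin_succ_eq_comp_right hs hx, iteratedFDerivWithin_succ_eq_comp_right hs hy]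
  simp only [Function.comp_apply]
  rw [← dist_eq_norm, LinearIsometryEquiv.dist_map, dist_eq_norm]

theorem holder_congr {m : ℕ} {α : ℝ} {s : Set ℂ} {f g : ℂ → E} (hf : HolderOn m α s f)
    (h : ∀ x ∈ s, g x = f x) : HolderOn m α s g := by
  obtain ⟨h1, C, hC, h2⟩ := hf
  refine ⟨h1.congr h, C, hC, fun x hx y hy => ?_⟩
  rw [iteratedFDerivWithin_congr h hx, iteratedFDerivWithin_congr h hy]
  exact h2 x hx y hy

theorem holder_clm {m : ℕ} {α : ℝ} {s : Set ℂ} {f : ℂ → E} (hs : UniqueDiffOn ℝ s)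
    (hf : HolderOn m α s f) (L : E →L[ℝ] F) : HolderOn m α s (fun x => L (f x)) := by
  obtain ⟨h1, C, hC, h2⟩ := hf
  refine ⟨L.contDiff.comp_contDiffOn h1, (‖L‖ + 1) * C, by positivity, fun x hx y hy => ?_⟩
  have e : ∀ x ∈ s, iteratedFDerivWithin ℝ m (fun x => L (f x)) s x =
      L.compContinuousMultilinearMap (iteratedFDerivWithin ℝ m f s x) := fun x hx =>
    L.iteratedFDerivWithin_comp_left (h1 x hx) hs hx le_rfl
  rw [e x hx, e y hy]
  have e2 : L.compContinuousMultilinearMap (iteratedFDerivWithin ℝ m f s x) -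
    L.compContinuousMultilinearMap (iteratedFDerivWithin ℝ m f s y) =
    L.compContinuousMultilinearMap (iteratedFDerivWithin ℝ m f s x - iteratedFDerivWithin ℝ m f s y) := by
    ext v; simp
  rw [e2]
  calc _ ≤ ‖L‖ * ‖iteratedFDerivWithin ℝ m f s x - iteratedFDerivWithin ℝ m f s y‖ :=
        L.norm_compContinuousMultilinearMap_le _
    _ ≤ (‖L‖ + 1) * (C * ‖x - y‖ ^ α) := by
        gcongr
        · linarith
        · exact h2 x hx y hy
    _ = _ := by ring

theorem holder_add {m : ℕ} {α : ℝ} {s : Set ℂ} {f g : ℂ → E} (hs : UniqueDiffOn ℝ s)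
    (hf : HolderOn m α s f) (hg : HolderOn m α s g) : HolderOn m α s (fun x => f x + g x) := by
  obtain ⟨h1, C, hC, h2⟩ := hf
  obtain ⟨h1', C', hC', h2'⟩ := hg
  refine ⟨h1.add h1', C + C', by positivity, fun x hx y hy => ?_⟩
  have e : ∀ x ∈ s, iteratedFDerivWithin ℝ m (fun x => f x + g x) s x =
      iteratedFDerivWithin ℝ m f s x + iteratedFDerivWithin ℝ m g s x := fun x hx =>
    iteratedFDerivWithin_add_apply (h1 x hx) (h1' x hx) hs hx
  rw [e x hx, e y hy, add_sub_add_comm, add_mul]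
  exact (norm_add_le _ _).trans (add_le_add (h2 x hx y hy) (h2' x hx y hy))

theorem holder_const {m : ℕ} {α : ℝ} {s : Set ℂ} (c : E) : HolderOn m α s (fun _ => c) := by
  refine ⟨contDiffOn_const, 1, one_pos, fun x hx y hy => ?_⟩
  rcases Nat.eq_zero_or_pos m with rfl | hm
  · simp only [iteratedFDerivWithin_zero_eq_comp, Function.comp_apply, sub_self, norm_zero]
    positivity
  · rw [iteratedFDerivWithin_const_of_ne hm.ne']
    simp only [Pi.zero_apply, sub_self, norm_zero]
    positivity

theorem holder_sum {ι : Type*} {m : ℕ} {α : ℝ} {s : Set ℂ} (hs : UniqueDiffOn ℝ s)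
    (t : Finset ι) {f : ι → ℂ → E} (h : ∀ i ∈ t, HolderOn m α s (f i)) :
    HolderOn m α s (fun x => ∑ i ∈ t, f i x) := by
  classical
  induction t using Finset.induction_on with
  | empty => simpa using holder_const (0 : E)
  | insert i t hi ih =>
    simp only [Finset.sum_insert hi]
    exact holder_add hs (h i (Finset.mem_insert_self _ _))
      (ih fun j hj => h j (Finset.mem_insert_of_mem hj))

theorem holder_pi {n m : ℕ} {α : ℝ} {s : Set ℂ} (hs : UniqueDiffOn ℝ s) {f : ℂ → Fin n → ℂ} :
    HolderOn m α s f ↔ ∀ j, HolderOn m α s (fun x => f x j) := by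
  constructor
  · intro h j
    exact holder_clm hs h (ContinuousLinearMap.proj (R := ℝ) (φ := fun _ : Fin n => ℂ) j)
  · intro h
    have := holder_sum hs Finset.univ (fun j _ => holder_clm hs (h j)
      (ContinuousLinearMap.single ℝ (fun _ : Fin n => ℂ) j))
    refine holder_congr this fun x _ => ?_
    ext i
    simp [Finset.sum_apply, Pi.single_apply]

theorem holder_mono {m : ℕ} {α : ℝ} {s t : Set ℂ} {f : ℂ → E} (hs : UniqueDiffOn ℝ s)
    (ht : UniqueDiffOn ℝ t) (hst : s ⊆ t) (hf : HolderOn m α t f) : HolderOn m α s f := by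
  obtain ⟨h1, C, hC, h2⟩ := hf
  refine ⟨h1.mono hst, C, hC, fun x hx y hy => ?_⟩
  rw [iteratedFDerivWithin_subset hst hs ht h1 hx, iteratedFDerivWithin_subset hst hs ht h1 hy]
  exact h2 x (hst hx) y (hst hy)

theorem uniq_closedBall {r : ℝ} (hr : 0 < r) (c : ℂ) : UniqueDiffOn ℝ (Metric.closedBall c r) :=
  uniqueDiffOn_convex (convex_closedBall c r)
    ⟨c, mem_interior_iff_mem_nhds.2 (Metric.closedBall_mem_nhds c hr)⟩

theorem rpow_dist_bound {α d R : ℝ} (hα : 0 < α) (hα1 : α < 1) (hd : 0 ≤ d) (hdR : d ≤ R) :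
    d ≤ R ^ (1 - α) * d ^ α := by
  rcases hd.eq_or_lt with rfl | hd
  · rw [Real.zero_rpow hα.ne']; simp
  calc d = d ^ (1 - α) * d ^ α := by rw [← Real.rpow_add hd]; simp
    _ ≤ _ := by
      gcongr

theorem holder_of_contDiffOn {m : ℕ} {α r : ℝ} {f : ℂ → E} (hα : 0 < α) (hα1 : α < 1) (hr : 0 < r)
    (hf : ContDiffOn ℝ (m + 1 : ℕ) f (Metric.closedBall 0 r)) :
    HolderOn m α (Metric.closedBall 0 r) f := by
  have hs := uniq_closedBall hr 0
  set s := Metric.closedBall (0 : ℂ) r with hs_def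
  have hc : IsCompact s := isCompact_closedBall _ _
  have h1 : ContinuousOn (iteratedFDerivWithin ℝ (m + 1) f s) s :=
    hf.continuousOn_iteratedFDerivWithin le_rfl hs
  obtain ⟨M, hM⟩ := hc.exists_bound_of_continuousOn h1
  have hd : DifferentiableOn ℝ (iteratedFDerivWithin ℝ m f s) s :=
    hf.differentiableOn_iteratedFDerivWithin (by exact_mod_cast Nat.lt_succ_self m) hs
  refine ⟨hf.of_le (by exact_mod_cast Nat.le_succ m), (|M| + 1) * (2 * r) ^ (1 - α), by positivity,
    fun x hx y hy => ?_⟩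
  have := (convex_closedBall (0 : ℂ) r).norm_image_sub_le_of_norm_fderivWithin_le (C := |M| + 1) hd
    (fun z hz => by
      rw [norm_fderivWithin_iteratedFDerivWithin]
      linarith [hM z hz, le_abs_self M]) hy hx
  refine this.trans ?_
  rw [mul_assoc]
  gcongr
  apply rpow_dist_bound hα hα1 (norm_nonneg _)
  simp only [hs_def, mem_closedBall_zero_iff] at hx hy
  linarith [norm_sub_le x y]

theorem holder_lower {m k : ℕ} {α r : ℝ} {f : ℂ → E} (hα : 0 < α) (hα1 : α < 1) (hr : 0 < r)
    (hmk : m ≤ k) (hf : HolderOn k α (Metric.closedBall 0 r) f) :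
    HolderOn m α (Metric.closedBall 0 r) f := by
  rcases hmk.eq_or_lt with rfl | h
  · exact hf
  · exact holder_of_contDiffOn hα hα1 hr (hf.1.of_le (by exact_mod_cast h))

/-- gluing -/
theorem holder_glue {m : ℕ} {α δ M : ℝ} {s s₁ s₂ : Set ℂ} {f : ℂ → E} (hα : 0 < α) (hδ : 0 < δ)
    (h : ∀ x ∈ s, s ∩ Metric.ball x δ = s₁ ∩ Metric.ball x δ ∨
      s ∩ Metric.ball x δ = s₂ ∩ Metric.ball x δ)
    (h₁ : HolderOn m α s₁ f) (h₂ : HolderOn m α s₂ f)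
    (hb₁ : ∀ x ∈ s₁, ‖iteratedFDerivWithin ℝ m f s₁ x‖ ≤ M)
    (hb₂ : ∀ x ∈ s₂, ‖iteratedFDerivWithin ℝ m f s₂ x‖ ≤ M) : HolderOn m α s f := by
  have key : ∀ {x : ℂ} {t : Set ℂ}, s ∩ Metric.ball x δ = t ∩ Metric.ball x δ →
      ∀ y ∈ Metric.ball x δ, s =ᶠ[nhds y] t := by
    intro x t ht y hy
    filter_upwards [Metric.isOpen_ball.mem_nhds hy] with z hz
    have := congrArg (fun A : Set ℂ => z ∈ A) ht
    simp only [Set.mem_inter_iff, hz, and_true] at this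
    exact this
  obtain ⟨c1, C1, hC1, e1⟩ := h₁
  obtain ⟨c2, C2, hC2, e2⟩ := h₂
  have mem : ∀ {x : ℂ} {t : Set ℂ}, s ∩ Metric.ball x δ = t ∩ Metric.ball x δ →
      ∀ y ∈ Metric.ball x δ, y ∈ s → y ∈ t := by
    intro x t ht y hy hys
    exact (ht ▸ (⟨hys, hy⟩ : y ∈ s ∩ Metric.ball x δ) : y ∈ t ∩ Metric.ball x δ).1
  have hbd : ∀ x ∈ s, ‖iteratedFDerivWithin ℝ m f s x‖ ≤ M := by
    intro x hx
    have hxx : x ∈ Metric.ball x δ := Metric.mem_ball_self hδ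
    rcases h x hx with h' | h'
    · rw [iteratedFDerivWithin_congr_set (key h' x hxx)]
      exact hb₁ x (mem h' x hxx hx)
    · rw [iteratedFDerivWithin_congr_set (key h' x hxx)]
      exact hb₂ x (mem h' x hxx hx)
  refine ⟨fun x hx => ?_, C1 + C2 + 2 * |M| / δ ^ α, by positivity, fun x hx y hy => ?_⟩
  · have hxx : x ∈ Metric.ball x δ := Metric.mem_ball_self hδ
    rcases h x hx with h' | h'
    · exact (c1 x (mem h' x hxx hx)).congr_set (key h' x hxx).symm
    · exact (c2 x (mem h' x hxx hx)).congr_set (key h' x hxx).symm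
  · have p0 : 0 ≤ ‖x - y‖ ^ α := by positivity
    have q0 : 0 ≤ 2 * |M| / δ ^ α := by positivity
    by_cases hxy : ‖x - y‖ < δ
    · have hyb : y ∈ Metric.ball x δ := by rwa [Metric.mem_ball, dist_comm, dist_eq_norm]
      have hxx : x ∈ Metric.ball x δ := Metric.mem_ball_self hδ
      rcases h x hx with h' | h'
      · rw [iteratedFDerivWithin_congr_set (key h' x hxx),
          iteratedFDerivWithin_congr_set (key h' y hyb)]
        refine (e1 x (mem h' x hxx hx) y (mem h' y hyb hy)).trans ?_
        gcongr; linarith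
      · rw [iteratedFDerivWithin_congr_set (key h' x hxx),
          iteratedFDerivWithin_congr_set (key h' y hyb)]
        refine (e2 x (mem h' x hxx hx) y (mem h' y hyb hy)).trans ?_
        gcongr; linarith
    · push Not at hxy
      have : δ ^ α ≤ ‖x - y‖ ^ α := by gcongr
      calc _ ≤ ‖iteratedFDerivWithin ℝ m f s x‖ + ‖iteratedFDerivWithin ℝ m f s y‖ := norm_sub_le _ _
        _ ≤ 2 * |M| := by linarith [hbd x hx, hbd y hy, le_abs_self M]
        _ = 2 * |M| / δ ^ α * δ ^ α := by field_simp
        _ ≤ 2 * |M| / δ ^ α * ‖x - y‖ ^ α := by gcongr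
        _ ≤ _ := by gcongr; linarith

end HolderAPI

/-- the real-linear map `h ↦ h.re * a + h.im * b`. -/
noncomputable def lin2 (a b : ℂ) : ℂ →L[ℝ] ℂ :=
  Complex.reCLM.smulRight a + Complex.imCLM.smulRight b

theorem lin2_of (L : ℂ →L[ℝ] ℂ) : L = lin2 (L 1) (L Complex.I) := by
  ext x
  have hx : x = x.re • (1 : ℂ) + x.im • Complex.I := by simp
  conv_lhs => rw [hx]
  rw [map_add, map_smul, map_smul]
  simp [lin2]

theorem lin2_of_holder {m : ℕ} {α : ℝ} {s : Set ℂ} {a b : ℂ → ℂ} (hs : UniqueDiffOn ℝ s)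
    (ha : HolderOn m α s a) (hb : HolderOn m α s b) :
    HolderOn m α s (fun x => lin2 (a x) (b x)) := by
  have h1 := holder_clm hs ha
    (ContinuousLinearMap.smulRightL ℝ ℂ ℂ Complex.reCLM)
  have h2 := holder_clm hs hb
    (ContinuousLinearMap.smulRightL ℝ ℂ ℂ Complex.imCLM)
  exact holder_add hs h1 h2

theorem holder_succ_of {m : ℕ} {α : ℝ} {s : Set ℂ} {f a b : ℂ → ℂ} (hs : UniqueDiffOn ℝ s)
    (ha : HolderOn m α s a) (hb : HolderOn m α s b)
    (hf : ∀ x ∈ s, HasFDerivWithinAt f (lin2 (a x) (b x)) s x) : HolderOn (m + 1) α s f := by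
  rw [holder_succ_iff hs]
  refine ⟨fun x hx => (hf x hx).differentiableWithinAt, ?_⟩
  exact holder_congr (lin2_of_holder hs ha hb) fun x hx => (hf x hx).fderivWithin (hs x hx)

theorem holder_succ_apply {m : ℕ} {α : ℝ} {s : Set ℂ} {f : ℂ → ℂ} (hs : UniqueDiffOn ℝ s)
    (hf : HolderOn (m + 1) α s f) (e : ℂ) : HolderOn m α s (fun x => fderivWithin ℝ f s x e) :=
  holder_clm hs ((holder_succ_iff hs).1 hf).2 (ContinuousLinearMap.apply ℝ ℂ e)

theorem holder_mul {α r : ℝ} (hα : 0 < α) (hα1 : α < 1) (hr : 0 < r) {m : ℕ} :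
    ∀ {f g : ℂ → ℂ}, HolderOn m α (Metric.closedBall 0 r) f →
      HolderOn m α (Metric.closedBall 0 r) g →
      HolderOn m α (Metric.closedBall 0 r) (fun x => f x * g x) := by
  have hs := uniq_closedBall hr 0
  have hc : IsCompact (Metric.closedBall (0 : ℂ) r) := isCompact_closedBall _ _
  induction m with
  | zero =>
    intro f g hf hg
    rw [holder_zero_iff] at hf hg ⊢
    obtain ⟨hf, C, hC, h1⟩ := hf
    obtain ⟨hg, C', hC', h2⟩ := hg
    obtain ⟨M, hM⟩ := hc.exists_bound_of_continuousOn hf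
    obtain ⟨M', hM'⟩ := hc.exists_bound_of_continuousOn hg
    refine ⟨hf.mul hg, |M| * C' + C * |M'| + 1, by positivity, fun x hx y hy => ?_⟩
    have : f x * g x - f y * g y = f x * (g x - g y) + (f x - f y) * g y := by ring
    rw [this]
    have p0 : 0 ≤ ‖x - y‖ ^ α := by positivity
    calc _ ≤ ‖f x * (g x - g y)‖ + ‖(f x - f y) * g y‖ := norm_add_le _ _
      _ ≤ |M| * (C' * ‖x - y‖ ^ α) + (C * ‖x - y‖ ^ α) * |M'| := by
        rw [norm_mul, norm_mul]
        gcongr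
        · exact (hM x hx).trans (le_abs_self _)
        · exact h2 x hx y hy
        · exact h1 x hx y hy
        · exact (hM' y hy).trans (le_abs_self _)
      _ ≤ _ := by nlinarith
  | succ m ih =>
    intro f g hf hg
    have hf0 := holder_lower hα hα1 hr (Nat.le_succ m) hf
    have hg0 := holder_lower hα hα1 hr (Nat.le_succ m) hg
    have p : ∀ e, HolderOn m α (Metric.closedBall 0 r) (fun x => f x * fderivWithin ℝ g
        (Metric.closedBall 0 r) x e + fderivWithin ℝ f (Metric.closedBall 0 r) x e * g x) :=
      fun e => holder_add hs (ih hf0 (holder_succ_apply hs hg e)) (ih (holder_succ_apply hs hf e) hg0)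
    refine holder_succ_of hs (p 1) (p Complex.I) fun x hx => ?_
    have h1 := (((holder_succ_iff hs).1 hf).1 x hx).hasFDerivWithinAt
    have h2 := (((holder_succ_iff hs).1 hg).1 x hx).hasFDerivWithinAt
    have h3 := h1.mul h2
    rw [lin2_of (f x • fderivWithin ℝ g _ x + g x • fderivWithin ℝ f _ x)] at h3
    simp only [ContinuousLinearMap.add_apply, ContinuousLinearMap.smul_apply, smul_eq_mul,
      mul_comm (g x)] at h3
    exact h3

end Part1

section Part2

theorem radial_integrable {f : ℝ → ℝ} (h : IntegrableOn (fun y => y * f y) (Set.Ioi 0)) :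
    Integrable (fun z : ℂ => f ‖z‖) := by
  rw [integrable_fun_norm_addHaar]
  simpa [Complex.finrank_real_complex] using h

noncomputable def rad1 (y : ℝ) : ℝ := if y ≤ 1 / 2 then y⁻¹ else 0
noncomputable def rad2 (α y : ℝ) : ℝ := if y ≤ 1 then y ^ (α - 2) else y ^ (α - 3)

theorem rad1_int : Integrable (fun z : ℂ => rad1 ‖z‖) := by
  apply radial_integrable
  have h1 : IntegrableOn (fun y : ℝ => (Set.Ioc (0 : ℝ) (1 / 2)).indicator (fun _ => (1 : ℝ)) y)
      (Set.Ioi 0) := by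
    apply Integrable.integrableOn
    rw [integrable_indicator_iff measurableSet_Ioc]
    apply integrableOn_const
    simp
    simp
  refine h1.congr_fun (fun y hy => ?_) measurableSet_Ioi
  have hy : 0 < y := hy
  by_cases h : y ≤ 1 / 2
  · simp only [rad1, if_pos h, Set.indicator_of_mem (show y ∈ Set.Ioc 0 (1 / 2) from ⟨hy, h⟩)]
    field_simp
  · have : y ∉ Set.Ioc 0 (1 / 2) := fun h' => h h'.2
    simp only [rad1, if_neg h, Set.indicator_of_notMem this, mul_zero]

theorem rad2_int {α : ℝ} (hα : 0 < α) (hα1 : α < 1) : Integrable (fun z : ℂ => rad2 α ‖z‖) := by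
  apply radial_integrable
  rw [← Set.Ioc_union_Ioi_eq_Ioi zero_le_one]
  apply IntegrableOn.union
  · have h : IntegrableOn (fun y : ℝ => y ^ (α - 1)) (Set.Ioc 0 1) := by
      rw [← intervalIntegrable_iff_integrableOn_Ioc_of_le zero_le_one]
      exact intervalIntegral.intervalIntegrable_rpow' (by linarith)
    refine h.congr_fun (fun y hy => ?_) measurableSet_Ioc
    simp only [rad2, if_pos hy.2]
    rw [show α - 1 = 1 + (α - 2) by ring, Real.rpow_add hy.1, Real.rpow_one]
  · have h : IntegrableOn (fun y : ℝ => y ^ (α - 2)) (Set.Ioi 1) :=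
      integrableOn_Ioi_rpow_of_lt (by linarith) one_pos
    refine h.congr_fun (fun y hy => ?_) measurableSet_Ioi
    have hy : 1 < y := hy
    simp only [rad2, if_neg (not_le.2 hy)]
    rw [show α - 2 = 1 + (α - 3) by ring, Real.rpow_add (by linarith), Real.rpow_one]

theorem rad_nonneg1 (y : ℝ) (hy : 0 ≤ y) : 0 ≤ rad1 y := by
  unfold rad1; split_ifs <;> positivity

theorem rad_nonneg2 (α y : ℝ) (hy : 0 ≤ y) : 0 ≤ rad2 α y := by
  unfold rad2; split_ifs <;> positivity

theorem ker_ptwise {α a b : ℝ} (hα : 0 < α) (hα1 : α < 1) (ha : 0 ≤ a) (hb : 0 ≤ b)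
    (h1 : 1 ≤ a + b) (h2 : a ≤ b + 1) :
    a ^ (α - 2) * b⁻¹ ≤ 4 * rad1 b + 5 * rad2 α a := by
  by_cases h : b ≤ 1 / 2
  · have ha2 : 1 / 2 ≤ a := by linarith
    have : a ^ (α - 2) ≤ 4 := by
      calc a ^ (α - 2) ≤ (1 / 2 : ℝ) ^ (α - 2) :=
            Real.rpow_le_rpow_of_nonpos (by norm_num) ha2 (by linarith)
        _ ≤ (1 / 2 : ℝ) ^ (-2 : ℝ) :=
            Real.rpow_le_rpow_of_exponent_ge (by norm_num) (by norm_num) (by linarith)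
        _ = 4 := by
          rw [Real.rpow_neg (by norm_num)]; norm_num
    have := rad_nonneg2 α a ha
    simp only [rad1, if_pos h]
    have hb' : 0 ≤ b⁻¹ := by positivity
    nlinarith
  · push Not at h
    have := rad_nonneg1 b hb
    have hb5 : b⁻¹ ≤ 5 * (1 + a)⁻¹ := by
      rw [← div_eq_mul_inv, inv_eq_one_div, div_le_div_iff₀ (by linarith) (by linarith)]
      linarith
    suffices a ^ (α - 2) * b⁻¹ ≤ 5 * rad2 α a by linarith
    calc a ^ (α - 2) * b⁻¹ ≤ a ^ (α - 2) * (5 * (1 + a)⁻¹) := by gcongr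
      _ = 5 * (a ^ (α - 2) * (1 + a)⁻¹) := by ring
      _ ≤ 5 * rad2 α a := by
        gcongr
        unfold rad2
        split_ifs with h'
        · have : (1 + a)⁻¹ ≤ 1 := inv_le_one_of_one_le₀ (by linarith)
          have : 0 ≤ a ^ (α - 2) := by positivity
          nlinarith
        · push Not at h'
          rw [show α - 3 = (α - 2) + (-1) by ring, Real.rpow_add (by linarith), Real.rpow_neg_one]
          gcongr
          linarith

theorem ker_unit {α : ℝ} (hα : 0 < α) (hα1 : α < 1) : ∃ C : ℝ, 0 < C ∧ ∀ e : ℂ, ‖e‖ = 1 →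
    Integrable (fun ω : ℂ => ‖ω‖ ^ (α - 2) * ‖ω - e‖⁻¹) ∧
    ∫ ω : ℂ, ‖ω‖ ^ (α - 2) * ‖ω - e‖⁻¹ ≤ C := by
  refine ⟨|∫ z : ℂ, 4 * rad1 ‖z‖| + |∫ z : ℂ, 5 * rad2 α ‖z‖| + 1, by positivity, fun e he => ?_⟩
  have i1 : Integrable (fun ω : ℂ => 4 * rad1 ‖ω - e‖) := (rad1_int.const_mul 4).comp_sub_right e
  have i2 : Integrable (fun ω : ℂ => 5 * rad2 α ‖ω‖) := (rad2_int hα hα1).const_mul 5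
  have pt : ∀ ω : ℂ, ‖ω‖ ^ (α - 2) * ‖ω - e‖⁻¹ ≤ 4 * rad1 ‖ω - e‖ + 5 * rad2 α ‖ω‖ := by
    intro ω
    apply ker_ptwise hα hα1 (norm_nonneg _) (norm_nonneg _)
    · have := norm_sub_le ω (ω - e); simp only [sub_sub_cancel, he] at this; linarith
    · have := norm_add_le (ω - e) e; simp only [sub_add_cancel, he] at this; linarith
  have hi : Integrable (fun ω : ℂ => ‖ω‖ ^ (α - 2) * ‖ω - e‖⁻¹) := by
    refine (i1.add i2).mono' (by measurability) (Filter.Eventually.of_forall fun ω => ?_)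
    rw [Real.norm_of_nonneg (by positivity)]
    exact pt ω
  refine ⟨hi, (integral_mono hi (i1.add i2) pt).trans ?_⟩
  simp only [Pi.add_apply]
  rw [integral_add i1 i2, integral_sub_right_eq_self (fun z : ℂ => 4 * rad1 ‖z‖) e]
  linarith [le_abs_self (∫ z : ℂ, 4 * rad1 ‖z‖), le_abs_self (∫ z : ℂ, 5 * rad2 α ‖z‖)]

theorem ker_bound {α : ℝ} (hα : 0 < α) (hα1 : α < 1) : ∃ C : ℝ, 0 < C ∧ ∀ x y : ℂ, x ≠ y →
    Integrable (fun ω : ℂ => ‖ω - x‖ ^ (α - 2) * ‖ω - y‖⁻¹) ∧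
    ∫ ω : ℂ, ‖ω - x‖ ^ (α - 2) * ‖ω - y‖⁻¹ ≤ C * ‖y - x‖ ^ (α - 1) := by
  obtain ⟨C, hC, h⟩ := ker_unit hα hα1
  refine ⟨C, hC, fun x y hxy => ?_⟩
  have hR : 0 < ‖y - x‖ := norm_pos_iff.2 (sub_ne_zero.2 (Ne.symm hxy))
  set R := ‖y - x‖ with hRd
  set e : ℂ := (R⁻¹ : ℝ) • (y - x) with he
  have he1 : ‖e‖ = 1 := by
    rw [he, norm_smul, norm_inv, Real.norm_of_nonneg hR.le, ← hRd]; field_simp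
  obtain ⟨hi, hl⟩ := h e he1
  set g : ℂ → ℝ := fun ω => ‖ω‖ ^ (α - 2) * ‖ω - (y - x)‖⁻¹ with hg
  have scale : ∀ ω : ℂ, g (R • ω) = R ^ (α - 3) * (‖ω‖ ^ (α - 2) * ‖ω - e‖⁻¹) := by
    intro ω
    have : R • ω - (y - x) = R • (ω - e) := by
      rw [he, smul_sub, smul_smul, mul_inv_cancel₀ hR.ne', one_smul]
    simp only [hg, this, norm_smul, Real.norm_of_nonneg hR.le]
    rw [Real.mul_rpow hR.le (norm_nonneg _), mul_inv, show α - 3 = (α - 2) + (-1) by ring,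
      Real.rpow_add hR, Real.rpow_neg_one]
    ring
  have gi : Integrable g := by
    rw [← integrable_comp_smul_iff volume g hR.ne']
    simp only [scale]
    exact hi.const_mul _
  have tr : ∀ ω, ‖ω - x‖ ^ (α - 2) * ‖ω - y‖⁻¹ = g (ω - x) := by
    intro ω; simp only [hg]; congr 3; ring
  simp only [tr]
  refine ⟨gi.comp_sub_right x, ?_⟩
  rw [integral_sub_right_eq_self g x]
  have := Measure.integral_comp_smul volume g R
  simp only [scale, integral_const_mul, Complex.finrank_real_complex, smul_eq_mul] at this
  rw [abs_of_nonneg (by positivity)] at this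
  have h2 : ∫ x, g x = R ^ 2 * (R ^ (α - 3) * ∫ ω : ℂ, ‖ω‖ ^ (α - 2) * ‖ω - e‖⁻¹) := by
    rw [this]; field_simp
  rw [h2, ← mul_assoc, ← Real.rpow_natCast, ← Real.rpow_add hR]
  rw [show ((2 : ℕ) : ℝ) + (α - 3) = α - 1 by push_cast; ring, mul_comm]
  gcongr

theorem inv_locInt : LocallyIntegrable (fun z : ℂ => z⁻¹) := by
  have h : ∀ r : ℝ, 0 < r → IntegrableOn (fun z : ℂ => z⁻¹) (Metric.ball 0 r) := by
    intro r hr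
    have h1 : Integrable (fun z : ℂ => (Set.Iio r).indicator (fun y => y⁻¹) ‖z‖) := by
      apply radial_integrable
      have h1 : IntegrableOn (fun y : ℝ => (Set.Ioo 0 r).indicator (fun _ => (1 : ℝ)) y)
          (Set.Ioi 0) := by
        apply Integrable.integrableOn
        rw [integrable_indicator_iff measurableSet_Ioo]
        apply integrableOn_const
        simp
        simp
      refine h1.congr_fun (fun y hy => ?_) measurableSet_Ioi
      have hy : 0 < y := hy
      by_cases h : y < r
      · simp only [Set.indicator_of_mem (show y ∈ Set.Ioo 0 r from ⟨hy, h⟩),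
          Set.indicator_of_mem (show y ∈ Set.Iio r from h)]
        field_simp
      · have h2 : y ∉ Set.Ioo 0 r := fun h' => h h'.2
        simp only [Set.indicator_of_notMem h2, Set.indicator_of_notMem (show y ∉ Set.Iio r from h),
          mul_zero]
    rw [← integrable_indicator_iff Metric.isOpen_ball.measurableSet]
    refine h1.mono' ?_ (Filter.Eventually.of_forall fun z => ?_)
    · exact (measurable_inv.indicator Metric.isOpen_ball.measurableSet).aestronglyMeasurable
    · by_cases hz : ‖z‖ < r
      · rw [Set.indicator_of_mem (by simpa using hz), Set.indicator_of_mem (by simpa using hz)]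
        simp
      · rw [Set.indicator_of_notMem (by simpa using hz), Set.indicator_of_notMem (by simpa using hz)]
        simp
  intro z
  refine ⟨Metric.ball 0 (‖z‖ + 1), Metric.isOpen_ball.mem_nhds (by simp), h _ (by positivity)⟩

end Part2

section Part3

theorem holder_zero_of {E : Type*} [NormedAddCommGroup E] [NormedSpace ℝ E] {α C : ℝ} {s : Set ℂ}
    {f : ℂ → E} (hα : 0 < α)
    (h : ∀ x ∈ s, ∀ y ∈ s, ‖f x - f y‖ ≤ C * ‖x - y‖ ^ α) : HolderOn 0 α s f := by
  rw [holder_zero_iff]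
  refine ⟨?_, |C| + 1, by positivity, fun x hx y hy => (h x hx y hy).trans ?_⟩
  · intro x hx
    rw [ContinuousWithinAt, tendsto_iff_norm_sub_tendsto_zero]
    have h0 : Filter.Tendsto (fun y => C * ‖y - x‖ ^ α) (nhdsWithin x s) (nhds 0) := by
      have : Continuous (fun y : ℂ => C * ‖y - x‖ ^ α) := by
        apply Continuous.mul continuous_const
        exact (continuous_id.sub continuous_const).norm.rpow_const fun _ => Or.inr hα.le
      have := this.tendsto x
      simp only [sub_self, norm_zero, Real.zero_rpow hα.ne', mul_zero] at this
      exact this.mono_left nhdsWithin_le_nhds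
    refine squeeze_zero' (Filter.Eventually.of_forall fun _ => norm_nonneg _) ?_ h0
    filter_upwards [self_mem_nhdsWithin] with y hy
    exact h y hy x hx
  · gcongr
    linarith [le_abs_self C]

theorem hasFDerivAt_of_bound {F : ℂ → ℂ} {L : ℂ →L[ℝ] ℂ} {x : ℂ} {α C : ℝ} (hα : 0 < α)
    (h : ∀ᶠ ζ in nhds x, ‖F ζ - F x - L (ζ - x)‖ ≤ C * ‖ζ - x‖ ^ (1 + α)) : HasFDerivAt F L x := by
  apply HasFDerivAt.of_isLittleO
  rw [Asymptotics.isLittleO_iff]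
  intro c hc
  have h0 : Filter.Tendsto (fun y => C * ‖y - x‖ ^ α) (nhds x) (nhds 0) := by
    have : Continuous (fun y : ℂ => C * ‖y - x‖ ^ α) := by
      apply Continuous.mul continuous_const
      exact (continuous_id.sub continuous_const).norm.rpow_const fun _ => Or.inr hα.le
    have := this.tendsto x
    simpa only [sub_self, norm_zero, Real.zero_rpow hα.ne', mul_zero] using this
  filter_upwards [h, h0.eventually (gt_mem_nhds hc)] with ζ h1 h2
  refine h1.trans ?_
  rcases eq_or_ne ζ x with rfl | hne
  · simp [Real.zero_rpow (show 1 + α ≠ 0 by linarith)]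
  · have : 0 < ‖ζ - x‖ := norm_pos_iff.2 (sub_ne_zero.2 hne)
    rw [Real.rpow_add this, Real.rpow_one]
    nlinarith

theorem campanato {F : ℂ → ℂ} {L : ℂ → ℂ →L[ℝ] ℂ} {α C : ℝ} (hα : 0 < α) (hα1 : α < 1)
    (h : ∀ x ∈ Metric.closedBall (0 : ℂ) 1, ∀ ζ ∈ Metric.closedBall (0 : ℂ) 5,
      ‖F ζ - F x - L x (ζ - x)‖ ≤ C * ‖ζ - x‖ ^ (1 + α)) :
    HolderOn 1 α (Metric.closedBall 0 1) F := by
  have hs := uniq_closedBall one_pos 0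
  have hd : ∀ x ∈ Metric.closedBall (0 : ℂ) 1, HasFDerivAt F (L x) x := by
    intro x hx
    apply hasFDerivAt_of_bound hα (C := C)
    have : Metric.closedBall (0 : ℂ) 5 ∈ nhds x := by
      refine Filter.mem_of_superset (Metric.ball_mem_nhds x one_pos) fun y hy => ?_
      simp only [Metric.mem_closedBall, Metric.mem_ball] at *
      linarith [dist_triangle y x 0]
    filter_upwards [this] with ζ hζ
    exact h x hx ζ hζ
  have hC : 0 ≤ C := by
    have := (norm_nonneg _).trans (h 0 (by simp) 1 (by simp))
    simpa using this
  have hfd : ∀ x ∈ Metric.closedBall (0 : ℂ) 1, fderivWithin ℝ F (Metric.closedBall 0 1) x = L x :=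
    fun x hx => ((hd x hx).hasFDerivWithinAt).fderivWithin (hs x hx)
  rw [show (1 : ℕ) = 0 + 1 from rfl, holder_succ_iff hs]
  refine ⟨fun x hx => (hd x hx).differentiableAt.differentiableWithinAt, ?_⟩
  refine holder_congr (f := L) ?_ hfd
  apply holder_zero_of hα (C := 6 * C)
  intro x hx y hy
  rcases eq_or_ne x y with rfl | hxy
  · simp; positivity
  have hδ : 0 < ‖x - y‖ := norm_pos_iff.2 (sub_ne_zero.2 hxy)
  set δ := ‖x - y‖ with hδd
  have hx1 : ‖x‖ ≤ 1 := by simpa using hx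
  have hy1 : ‖y‖ ≤ 1 := by simpa using hy
  have hδ2 : δ ≤ 2 := by linarith [norm_sub_le x y]
  refine ContinuousLinearMap.opNorm_le_of_unit_norm (by positivity) fun e he => ?_
  have e1 := h x hx (x + δ • e) (by
    simp only [mem_closedBall_zero_iff]
    refine (norm_add_le _ _).trans ?_
    rw [norm_smul, he, Real.norm_of_nonneg hδ.le]; linarith)
  have e2 := h y hy (x + δ • e) (by
    simp only [mem_closedBall_zero_iff]
    refine (norm_add_le _ _).trans ?_
    rw [norm_smul, he, Real.norm_of_nonneg hδ.le]; linarith)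
  have e3 := h y hy x (by simp only [mem_closedBall_zero_iff]; linarith)
  have n1 : ‖x + δ • e - x‖ = δ := by
    rw [add_sub_cancel_left, norm_smul, he, Real.norm_of_nonneg hδ.le, mul_one]
  have n2 : ‖x + δ • e - y‖ ≤ 2 * δ := by
    calc ‖x + δ • e - y‖ = ‖(x - y) + δ • e‖ := by congr 1; ring
      _ ≤ δ + δ := by
        refine (norm_add_le _ _).trans ?_
        rw [norm_smul, he, Real.norm_of_nonneg hδ.le, mul_one]
      _ = _ := by ring
  have p2 : ‖x + δ • e - y‖ ^ (1 + α) ≤ 4 * δ ^ (1 + α) := by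
    calc ‖x + δ • e - y‖ ^ (1 + α) ≤ (2 * δ) ^ (1 + α) := by gcongr
      _ = 2 ^ (1 + α) * δ ^ (1 + α) := Real.mul_rpow (by norm_num) hδ.le
      _ ≤ 4 * δ ^ (1 + α) := by
        gcongr
        calc (2 : ℝ) ^ (1 + α) ≤ 2 ^ (2 : ℝ) :=
              Real.rpow_le_rpow_of_exponent_le (by norm_num) (by linarith)
          _ = 4 := by norm_num
  rw [n1] at e1
  have e2' := e2.trans (mul_le_mul_of_nonneg_left p2 hC)
  have key : δ • ((L x - L y) e) = -(F (x + δ • e) - F x - L x (x + δ • e - x)) +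
      (F (x + δ • e) - F y - L y (x + δ • e - y)) - (F x - F y - L y (x - y)) := by
    have : x + δ • e - y = (x - y) + δ • e := by ring
    rw [this, add_sub_cancel_left]
    simp only [map_add, map_smul, _root_.sub_apply, smul_sub]
    ring
  have : δ * ‖(L x - L y) e‖ ≤ δ * (6 * C * δ ^ α) := by
    calc δ * ‖(L x - L y) e‖ = ‖δ • ((L x - L y) e)‖ := by
          rw [norm_smul, Real.norm_of_nonneg hδ.le]
      _ ≤ C * δ ^ (1 + α) + C * (4 * δ ^ (1 + α)) + C * δ ^ (1 + α) := by
        rw [key]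
        refine (norm_sub_le _ _).trans (add_le_add ((norm_add_le _ _).trans (add_le_add ?_ e2')) e3)
        rwa [norm_neg]
      _ = δ * (6 * C * δ ^ α) := by
        rw [Real.rpow_add hδ, Real.rpow_one]; ring
  exact le_of_mul_le_mul_left this hδ

/-- Cauchy potential over the plane. -/
noncomputable def pot (v : ℂ → ℂ) (ζ : ℂ) : ℂ := ∫ ω, (ζ - ω)⁻¹ * v ω

theorem pot_eq_conv (v : ℂ → ℂ) :
    pot v = convolution (fun z : ℂ => z⁻¹) v (ContinuousLinearMap.mul ℝ ℂ) volume := by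
  ext ζ
  rw [convolution_eq_swap]
  rfl

theorem pot_integrable {v : ℂ → ℂ} (hc : Continuous v) (hs : HasCompactSupport v) (ζ : ℂ) :
    Integrable (fun ω => (ζ - ω)⁻¹ * v ω) :=
  (HasCompactSupport.convolutionExists_right (ContinuousLinearMap.mul ℝ ℂ) hs inv_locInt hc
    ζ).integrable_swap

theorem pot_deriv {v : ℂ → ℂ} (hc : ContDiff ℝ 1 v) (hs : HasCompactSupport v) (ζ : ℂ) :
    HasFDerivAt (pot v) (lin2 (pot (fun ω => fderiv ℝ v ω 1) ζ)
      (pot (fun ω => fderiv ℝ v ω Complex.I) ζ)) ζ := by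
  have h := HasCompactSupport.hasFDerivAt_convolution_right (ContinuousLinearMap.mul ℝ ℂ) hs
    inv_locInt hc ζ
  rw [lin2_of (convolution (fun z : ℂ => z⁻¹) (fderiv ℝ v) _ _ ζ)] at h
  rw [convolution_precompR_apply _ inv_locInt (hs.fderiv ℝ) (hc.continuous_fderiv one_ne_zero),
    convolution_precompR_apply _ inv_locInt (hs.fderiv ℝ) (hc.continuous_fderiv one_ne_zero)] at h
  simpa only [pot_eq_conv] using h

theorem pot_contDiff {v : ℂ → ℂ} {n : ℕ∞} (hc : ContDiff ℝ n v) (hs : HasCompactSupport v) :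
    ContDiff ℝ n (pot v) := by
  rw [pot_eq_conv]
  exact hs.contDiff_convolution_right _ inv_locInt hc

theorem pot_est {α : ℝ} (hα : 0 < α) (hα1 : α < 1) : ∃ K > 0, ∀ (g : ℂ → ℂ) (C : ℝ) (x : ℂ),
    Continuous g → HasCompactSupport g → 0 ≤ C → (∀ ω, ‖g ω‖ ≤ C * ‖ω - x‖ ^ α) →
    ∀ ζ, ‖pot g ζ - pot g x - (ζ - x) * (-∫ ω, ((x - ω) ^ 2)⁻¹ * g ω)‖ ≤
      C * K * ‖ζ - x‖ ^ (1 + α) := by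
  obtain ⟨K, hK, hker⟩ := ker_bound hα hα1
  refine ⟨K, hK, fun g C x hc hs hC hg => ?_⟩
  set R : ℂ → ℂ → ℂ := fun ζ ω => (ζ - x) ^ 2 * (((x - ω) ^ 2)⁻¹ * (ζ - ω)⁻¹ * g ω) with hR
  have hRb : ∀ ζ ω, ‖R ζ ω‖ ≤ C * ‖ζ - x‖ ^ 2 * (‖ω - x‖ ^ (α - 2) * ‖ω - ζ‖⁻¹) := by
    intro ζ ω
    rcases eq_or_ne ω x with rfl | hne
    · simp only [hR, sub_self, ne_eq, OfNat.ofNat_ne_zero, not_false_eq_true, zero_pow, _root_.inv_zero,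
        zero_mul, mul_zero, norm_zero]
      positivity
    have hp : 0 < ‖ω - x‖ := norm_pos_iff.2 (sub_ne_zero.2 hne)
    simp only [hR, norm_mul, norm_pow, norm_inv]
    rw [norm_sub_rev x ω, norm_sub_rev ζ ω, Real.rpow_sub hp, Real.rpow_two]
    calc _ ≤ ‖ζ - x‖ ^ 2 * ((‖ω - x‖ ^ 2)⁻¹ * ‖ω - ζ‖⁻¹ * (C * ‖ω - x‖ ^ α)) := by
          gcongr; exact hg ω
      _ = _ := by ring
  have hRi : ∀ ζ, x ≠ ζ → Integrable (R ζ) := by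
    intro ζ hne
    refine ((hker x ζ hne).1.const_mul (C * ‖ζ - x‖ ^ 2)).mono' ?_
      (Filter.Eventually.of_forall (hRb ζ))
    apply Measurable.aestronglyMeasurable
    have := hc.measurable
    fun_prop
  have ptw : ∀ ζ, ∀ᵐ ω : ℂ, R ζ ω = (ζ - ω)⁻¹ * g ω - (x - ω)⁻¹ * g ω +
      (ζ - x) * (((x - ω) ^ 2)⁻¹ * g ω) := by
    intro ζ
    have a1 : ∀ᵐ ω : ℂ, ω ≠ ζ := by simp [ae_iff]
    have a2 : ∀ᵐ ω : ℂ, ω ≠ x := by simp [ae_iff]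
    filter_upwards [a1, a2] with ω h1 h2
    have h1 : ζ - ω ≠ 0 := sub_ne_zero.2 (Ne.symm h1)
    have h2 : x - ω ≠ 0 := sub_ne_zero.2 (Ne.symm h2)
    simp only [hR]
    field_simp
    ring
  have hi : ∀ ζ, Integrable (fun ω => (ζ - ω)⁻¹ * g ω) := pot_integrable hc hs
  have hA : Integrable (fun ω => ((x - ω) ^ 2)⁻¹ * g ω) := by
    have := ((hRi (x + 1) (by simp)).sub ((hi (x + 1)).sub (hi x)))
    refine this.congr ?_
    filter_upwards [ptw (x + 1)] with ω hω
    simp only [Pi.sub_apply, hω]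
    ring
  intro ζ
  rcases eq_or_ne x ζ with rfl | hne
  · simp; positivity
  have : pot g ζ - pot g x - (ζ - x) * (-∫ ω, ((x - ω) ^ 2)⁻¹ * g ω) = ∫ ω, R ζ ω := by
    rw [integral_congr_ae (ptw ζ), integral_add (f := fun ω => (ζ - ω)⁻¹ * g ω - (x - ω)⁻¹ * g ω)
      ((hi ζ).sub (hi x)) (hA.const_mul _), integral_sub (hi ζ) (hi x), integral_const_mul]
    simp only [pot]
    ring
  rw [this]
  have hk := hker x ζ hne
  have hh : 0 < ‖ζ - x‖ := norm_pos_iff.2 (sub_ne_zero.2 (Ne.symm hne))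
  calc ‖∫ ω, R ζ ω‖ ≤ ∫ ω, C * ‖ζ - x‖ ^ 2 * (‖ω - x‖ ^ (α - 2) * ‖ω - ζ‖⁻¹) :=
        norm_integral_le_of_norm_le (hk.1.const_mul _) (Filter.Eventually.of_forall (hRb ζ))
    _ ≤ C * ‖ζ - x‖ ^ 2 * (K * ‖ζ - x‖ ^ (α - 1)) := by
        rw [integral_const_mul]
        gcongr
        exact hk.2
    _ = C * K * ‖ζ - x‖ ^ (1 + α) := by
        rw [show 1 + α = 2 + (α - 1) by ring, Real.rpow_add hh, Real.rpow_two]; ring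

end Part3

section Part4

/-- smooth cutoffs -/
theorem exists_cutoff {a b : ℝ} (ha : 0 < a) (hab : a < b) : ∃ χ : ℂ → ℂ, ContDiff ℝ (⊤ : ℕ∞) χ ∧
    HasCompactSupport χ ∧ (∀ z, ‖z‖ ≤ a → χ z = 1) ∧ (∀ z, b ≤ ‖z‖ → χ z = 0) ∧ ∀ z, ‖χ z‖ ≤ 1 := by
  let f : ContDiffBump (0 : ℂ) := ⟨a, b, ha, hab⟩
  refine ⟨fun z => ((f z : ℝ) : ℂ), ?_, ?_, ?_, ?_, ?_⟩
  · exact Complex.ofRealCLM.contDiff.comp f.contDiff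
  · exact f.hasCompactSupport.comp_left (g := fun x : ℝ => (x : ℂ)) (by simp)
  · intro z hz
    show ((f z : ℝ) : ℂ) = 1
    rw [f.one_of_mem_closedBall (by simpa using hz)]; simp
  · intro z hz
    show ((f z : ℝ) : ℂ) = 0
    rw [f.zero_of_le_dist (by simpa using hz)]; simp
  · intro z
    rw [Complex.norm_real, Real.norm_of_nonneg f.nonneg]
    exact f.le_one

theorem smooth_cpt_holder {α : ℝ} (hα : 0 < α) (hα1 : α < 1) {χ : ℂ → ℂ}
    (h1 : ContDiff ℝ (⊤ : ℕ∞) χ) (h2 : HasCompactSupport χ) (h3 : ∀ z, ‖χ z‖ ≤ 1) :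
    ∃ C, 0 ≤ C ∧ ∀ x y, ‖χ x - χ y‖ ≤ C * ‖x - y‖ ^ α := by
  obtain ⟨K, hK⟩ := (h1.of_le (m := 1) (by exact_mod_cast le_top)).lipschitzWith_of_hasCompactSupport
    h2 one_ne_zero
  refine ⟨K + 2, by positivity, fun x y => ?_⟩
  have p0 : 0 ≤ ‖x - y‖ ^ α := by positivity
  have hK0 : (0 : ℝ) ≤ K := K.2
  by_cases h : ‖x - y‖ ≤ 1
  · have := hK.norm_sub_le x y
    have h4 := rpow_dist_bound hα hα1 (norm_nonneg (x - y)) h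
    rw [Real.one_rpow, one_mul] at h4
    nlinarith
  · push Not at h
    have h5 : 1 ≤ ‖x - y‖ ^ α := Real.one_le_rpow h.le hα.le
    have := (norm_sub_le (χ x) (χ y))
    nlinarith [h3 x, h3 y]

theorem taylor_bound {α : ℝ} (hα : 0 < α) (hα1 : α < 1) {P : ℂ → ℂ} (hP : ContDiff ℝ 2 P) :
    ∃ C, 0 ≤ C ∧ ∀ x ∈ Metric.closedBall (0 : ℂ) 5, ∀ ζ ∈ Metric.closedBall (0 : ℂ) 5,
      ‖P ζ - P x - fderiv ℝ P x (ζ - x)‖ ≤ C * ‖ζ - x‖ ^ (1 + α) := by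
  have h1 : ContDiff ℝ (0 + 1 : ℕ) (fderiv ℝ P) := hP.fderiv_right (by norm_num)
  have h2 := holder_of_contDiffOn (m := 0) hα hα1 (show (0 : ℝ) < 5 by norm_num) h1.contDiffOn
  rw [holder_zero_iff] at h2
  obtain ⟨_, C, hC, h3⟩ := h2
  refine ⟨C, hC.le, fun x hx ζ hζ => ?_⟩
  have hconv : Convex ℝ (Metric.closedBall (0 : ℂ) 5 ∩ Metric.closedBall x ‖ζ - x‖) :=
    (convex_closedBall _ _).inter (convex_closedBall _ _)
  have := hconv.norm_image_sub_le_of_norm_hasFDerivWithin_le' (f := P) (f' := fderiv ℝ P)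
    (φ := fderiv ℝ P x) (C := C * ‖ζ - x‖ ^ α) (x := x) (y := ζ)
    (fun y _ => ((hP.differentiable two_ne_zero) y).hasFDerivAt.hasFDerivWithinAt)
    (fun y hy => by
      refine (h3 y hy.1 x hx).trans ?_
      have h6 : ‖y - x‖ ≤ ‖ζ - x‖ := by simpa [dist_eq_norm] using hy.2
      gcongr)
    ⟨hx, Metric.mem_closedBall_self (norm_nonneg _)⟩ ⟨hζ, by simp [dist_eq_norm]⟩
  refine this.trans (le_of_eq ?_)
  rcases eq_or_ne ζ x with rfl | hne
  · simp [Real.zero_rpow (show 1 + α ≠ 0 by linarith)]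
  · rw [Real.rpow_add (norm_pos_iff.2 (sub_ne_zero.2 hne)), Real.rpow_one]; ring

theorem pot_base {α : ℝ} (hα : 0 < α) (hα1 : α < 1) {v : ℂ → ℂ} (hc : Continuous v)
    (hs : HasCompactSupport v) {C : ℝ} (hC : 0 ≤ C) (hv : ∀ x y, ‖v x - v y‖ ≤ C * ‖x - y‖ ^ α) :
    HolderOn 1 α (Metric.closedBall 0 1) (pot v) := by
  obtain ⟨χ, c1, c2, c3, -, c5⟩ := exists_cutoff one_pos one_lt_two
  obtain ⟨Cχ, hCχ, c6⟩ := smooth_cpt_holder hα hα1 c1 c2 c5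
  obtain ⟨M, hM⟩ := hs.exists_bound_of_continuous hc
  have hM0 : 0 ≤ M := (norm_nonneg _).trans (hM 0)
  obtain ⟨K, hK, hest⟩ := pot_est hα hα1
  have hP2 : ContDiff ℝ 2 (pot χ) := pot_contDiff (n := 2) (c1.of_le (by exact_mod_cast le_top)) c2
  obtain ⟨CP, hCP, hP⟩ := taylor_bound hα hα1 hP2
  let g : ℂ → ℂ → ℂ := fun x ω => v ω - v x * χ ω
  have hgc : ∀ x, Continuous (g x) := fun x => hc.sub (continuous_const.mul c1.continuous)
  have hgs : ∀ x, HasCompactSupport (g x) := fun x => hs.sub c2.mul_left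
  have hg : ∀ x ∈ Metric.closedBall (0 : ℂ) 1, ∀ ω, ‖g x ω‖ ≤ (C + M * Cχ) * ‖ω - x‖ ^ α := by
    intro x hx ω
    have : g x ω = (v ω - v x) - v x * (χ ω - χ x) := by
      simp only [g, c3 x (by simpa using hx)]; ring
    rw [this, add_mul]
    refine (norm_sub_le _ _).trans (add_le_add (hv ω x) ?_)
    rw [norm_mul, mul_assoc]
    gcongr
    · exact hM x
    · exact c6 ω x
  have hsplit : ∀ x ζ, pot v ζ = v x * pot χ ζ + pot (g x) ζ := by
    intro x ζ
    simp only [pot, g]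
    rw [← integral_const_mul, ← integral_add ((pot_integrable c1.continuous c2 ζ).const_mul _)
      (pot_integrable (hgc x) (hgs x) ζ)]
    congr 1
    ext ω
    ring
  let A : ℂ → ℂ := fun x => -∫ ω, ((x - ω) ^ 2)⁻¹ * g x ω
  refine campanato (C := M * CP + (C + M * Cχ) * K) (L := fun x =>
    (ContinuousLinearMap.mul ℝ ℂ (v x)).comp (fderiv ℝ (pot χ) x) +
      ContinuousLinearMap.mul ℝ ℂ (A x)) hα hα1 fun x hx ζ hζ => ?_
  have h5 : x ∈ Metric.closedBall (0 : ℂ) 5 := Metric.closedBall_subset_closedBall (by norm_num) hx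
  have e1 := hP x h5 ζ hζ
  have e2 := hest (g x) (C + M * Cχ) x (hgc x) (hgs x) (by positivity) (hg x hx) ζ
  have : pot v ζ - pot v x - ((ContinuousLinearMap.mul ℝ ℂ (v x)).comp (fderiv ℝ (pot χ) x) +
      ContinuousLinearMap.mul ℝ ℂ (A x)) (ζ - x) =
      v x * (pot χ ζ - pot χ x - fderiv ℝ (pot χ) x (ζ - x)) +
      (pot (g x) ζ - pot (g x) x - (ζ - x) * A x) := by
    rw [hsplit x ζ, hsplit x x]
    simp only [_root_.add_apply, ContinuousLinearMap.comp_apply,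
      ContinuousLinearMap.mul_apply']
    ring
  rw [this, add_mul]
  refine (norm_add_le _ _).trans (add_le_add ?_ e2)
  rw [norm_mul, mul_assoc]
  gcongr
  exact hM x

theorem pot_holder {α : ℝ} (hα : 0 < α) (hα1 : α < 1) {m : ℕ} : ∀ {v : ℂ → ℂ},
    HasCompactSupport v → HolderOn m α Set.univ v →
    HolderOn (m + 1) α (Metric.closedBall 0 1) (pot v) := by
  have hs := uniq_closedBall one_pos 0
  induction m with
  | zero =>
    intro v hv h
    rw [holder_zero_iff] at h
    obtain ⟨h1, C, hC, h2⟩ := h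
    exact pot_base hα hα1 (continuousOn_univ.1 h1) hv hC.le
      fun x y => h2 x (Set.mem_univ _) y (Set.mem_univ _)
  | succ m ih =>
    intro v hv h
    have hc : ContDiff ℝ 1 v := (contDiffOn_univ.1 h.1).of_le (by
      exact_mod_cast Nat.le_add_left 1 m)
    have hd : ∀ e, HolderOn (m + 1) α (Metric.closedBall 0 1) (pot fun ω => fderiv ℝ v ω e) := by
      intro e
      apply ih
      · exact (hv.fderiv ℝ).comp_left (g := fun L : ℂ →L[ℝ] ℂ => L e) (by simp)
      · simpa only [fderivWithin_univ] using holder_succ_apply uniqueDiffOn_univ h e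
    exact holder_succ_of hs (hd 1) (hd Complex.I) fun x _ => (pot_deriv hc hv x).hasFDerivWithinAt

theorem bdd_of_holder {E : Type*} [NormedAddCommGroup E] [NormedSpace ℝ E] {α : ℝ} (hα : 0 < α)
    {m : ℕ} {s : Set ℂ} {f : ℂ → E} (h : HolderOn m α s f) {R : ℝ} (hs : ∀ x ∈ s, ‖x‖ ≤ R) :
    ∃ M, ∀ x ∈ s, ‖iteratedFDerivWithin ℝ m f s x‖ ≤ M := by
  rcases s.eq_empty_or_nonempty with rfl | ⟨y, hy⟩
  · exact ⟨0, by simp⟩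
  obtain ⟨_, C, hC, h2⟩ := h
  refine ⟨C * (2 * R) ^ α + ‖iteratedFDerivWithin ℝ m f s y‖, fun x hx => ?_⟩
  have e1 := norm_le_norm_sub_add (iteratedFDerivWithin ℝ m f s x) (iteratedFDerivWithin ℝ m f s y)
  have : ‖x - y‖ ≤ 2 * R := by linarith [norm_sub_le x y, hs x hx, hs y hy]
  have e3 : C * ‖x - y‖ ^ α ≤ C * (2 * R) ^ α := by gcongr
  linarith [h2 x hx y hy]

theorem holder_extend_zero {α : ℝ} (hα : 0 < α) {m : ℕ} {v : ℂ → ℂ} {a b : ℝ}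
    (hab : a < b) (hv : HolderOn m α (Metric.closedBall 0 b) v) (h0 : ∀ z, a ≤ ‖z‖ → v z = 0) :
    HolderOn m α Set.univ v := by
  have h2 : HolderOn m α {z : ℂ | a ≤ ‖z‖} v := holder_congr (holder_const 0) h0
  obtain ⟨M, hM⟩ := bdd_of_holder hα hv (R := b) (fun x hx => by simpa using hx)
  have hδ : 0 < (b - a) / 2 := by linarith
  refine holder_glue (M := |M|) hα hδ ?_ hv h2 (fun x hx => (hM x hx).trans (le_abs_self _)) ?_
  · intro x _
    by_cases hx : ‖x‖ ≤ (a + b) / 2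
    · left
      ext y
      simp only [Set.mem_inter_iff, Set.mem_univ, true_and, Metric.mem_ball, mem_closedBall_zero_iff,
        dist_eq_norm]
      constructor
      · intro hy
        refine ⟨?_, hy⟩
        have := norm_le_norm_sub_add y x
        linarith
      · exact fun h => h.2
    · right
      push Not at hx
      ext y
      simp only [Set.mem_inter_iff, Set.mem_univ, true_and, Metric.mem_ball, Set.mem_ofPred_eq,
        dist_eq_norm]
      constructor
      · intro hy
        refine ⟨?_, hy⟩
        have := norm_le_norm_sub_add x y
        rw [norm_sub_rev] at this
        linarith
      · exact fun h => h.2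
  · intro x hx
    rw [iteratedFDerivWithin_congr (s := {z : ℂ | a ≤ ‖z‖}) (f := fun _ => (0 : ℂ)) h0 hx]
    have : iteratedFDerivWithin ℝ m (fun _ : ℂ => (0 : ℂ)) {z : ℂ | a ≤ ‖z‖} x = 0 := by
      simp
    rw [this, norm_zero]
    positivity

end Part4

section Part5

theorem param_int {X : Type*} [MeasurableSpace X] {μ : Measure X} {G p : X → ℂ}
    (hG : Measurable G) (hp : Integrable p μ) {ζ₀ : ℂ} {d : ℝ} (hd : 0 < d)
    (h : ∀ᵐ x ∂μ, p x = 0 ∨ d ≤ ‖G x - ζ₀‖) : Integrable (fun x => p x / (G x - ζ₀)) μ := by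
  refine (hp.norm.mul_const d⁻¹).mono' ?_ ?_
  · simp only [div_eq_mul_inv]
    exact hp.aestronglyMeasurable.mul
      ((hG.sub measurable_const).inv.aestronglyMeasurable)
  · filter_upwards [h] with x hx
    rw [norm_div, div_eq_mul_inv]
    rcases hx with hx | hx
    · simp [hx]
    · gcongr

theorem param_deriv {X : Type*} [MeasurableSpace X] {μ : Measure X} {G p : X → ℂ}
    (hG : Measurable G) (hp : Integrable p μ) {ζ₀ : ℂ} {d : ℝ} (hd : 0 < d)
    (h : ∀ᵐ x ∂μ, p x = 0 ∨ d ≤ ‖G x - ζ₀‖) :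
    HasDerivAt (fun ζ => ∫ x, p x / (G x - ζ) ∂μ) (∫ x, p x / (G x - ζ₀) ^ 2 ∂μ) ζ₀ := by
  refine (hasDerivAt_integral_of_dominated_loc_of_deriv_le (s := Metric.ball ζ₀ (d / 2))
    (bound := fun x => ‖p x‖ * ((d / 2) ^ 2)⁻¹) (F := fun ζ x => p x / (G x - ζ))
    (F' := fun ζ x => p x / (G x - ζ) ^ 2)
    (Metric.ball_mem_nhds _ (by positivity)) ?_ (param_int hG hp hd h) ?_ ?_ ?_ ?_).2
  · refine Filter.Eventually.of_forall fun ζ => ?_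
    simp only [div_eq_mul_inv]
    exact hp.aestronglyMeasurable.mul
      ((hG.sub measurable_const).inv.aestronglyMeasurable)
  · simp only [div_eq_mul_inv]
    exact hp.aestronglyMeasurable.mul
      (((hG.sub measurable_const).pow_const 2).inv.aestronglyMeasurable)
  · filter_upwards [h] with x hx ζ hζ
    rw [norm_div, div_eq_mul_inv, norm_pow]
    rcases hx with hx | hx
    · simp [hx]
    · have h1 : ‖ζ - ζ₀‖ < d / 2 := by simpa [dist_eq_norm] using hζ
      have h2 : d / 2 ≤ ‖G x - ζ‖ := by
        have := norm_sub_le_norm_sub_add_norm_sub (G x) ζ ζ₀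
        linarith
      gcongr
  · exact hp.norm.mul_const _
  · filter_upwards [h] with x hx ζ hζ
    rcases hx with hx | hx
    · simp only [hx, zero_div]; exact hasDerivAt_const _ _
    · have h1 : ‖ζ - ζ₀‖ < d / 2 := by simpa [dist_eq_norm] using hζ
      have h2 : G x - ζ ≠ 0 := by
        intro h0
        have := norm_sub_le_norm_sub_add_norm_sub (G x) ζ ζ₀
        rw [h0, norm_zero] at this
        linarith
      have h3 := ((hasDerivAt_id ζ).const_sub (G x)).inv h2
      have h4 := h3.const_mul (p x)
      refine HasDerivAt.congr_deriv (f' := p x * (- -1 / (G x - ζ) ^ 2)) h4 ?_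
      rw [neg_neg, ← mul_div_assoc, mul_one]

theorem holder_of_holo {α : ℝ} (hα : 0 < α) (hα1 : α < 1) {m : ℕ} {r a : ℝ} (hr : 0 < r)
    (hra : r < a) {f : ℂ → ℂ} (hf : DifferentiableOn ℂ f (Metric.ball 0 a)) :
    HolderOn m α (Metric.closedBall 0 r) f := by
  apply holder_of_contDiffOn hα hα1 hr
  have : ContDiffOn ℂ (m + 1 : ℕ) f (Metric.ball 0 a) := hf.contDiffOn Metric.isOpen_ball
  exact (this.restrict_scalars ℝ).mono (Metric.closedBall_subset_ball hra)

theorem interior_step {α : ℝ} (hα : 0 < α) (hα1 : α < 1) {m : ℕ} {u : ℂ → ℂ}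
    (hu : ContinuousOn u (Metric.closedBall 0 1))
    (h : ∀ r : ℝ, 0 < r → r < 1 → HolderOn m α (Metric.closedBall 0 r) u) (r : ℝ) (hr : 0 < r)
    (hr1 : r < 1) : HolderOn (m + 1) α (Metric.closedBall 0 r) (cauchyGreen u) := by
  set a := r + (1 - r) / 4 with ha
  set b := r + (1 - r) / 2 with hb
  set c := r + 3 * (1 - r) / 4 with hc
  have hra : r < a := by linarith
  have hab : a < b := by linarith
  have hbc : b < c := by linarith
  have hc1 : c < 1 := by linarith
  obtain ⟨χ, c1, c2, c3, c4, c5⟩ := exists_cutoff (hr.trans hra) hab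
  have hs := uniq_closedBall hr 0
  set v : ℂ → ℂ := fun z => χ z * u z with hv
  have hvc : HolderOn m α (Metric.closedBall 0 c) v := by
    refine holder_mul hα hα1 (by linarith) ?_ (h c (by linarith) hc1)
    apply holder_of_contDiffOn hα hα1 (by linarith)
    exact (c1.of_le (by exact_mod_cast le_top)).contDiffOn
  have hv0 : ∀ z, b ≤ ‖z‖ → v z = 0 := fun z hz => by simp [hv, c4 z hz]
  have hvu := holder_extend_zero hα hbc hvc hv0
  have hvs : HasCompactSupport v := c2.mul_right
  have hvcont : Continuous v := continuousOn_univ.1 hvu.1.continuousOn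
  have hp := pot_holder hα hα1 hvs hvu
  set μ := volume.restrict unitDisc with hμ
  have hui : Integrable u μ := by
    have : IntegrableOn u (Metric.closedBall 0 1) := hu.integrableOn_compact (isCompact_closedBall _ _)
    exact this.mono_set Metric.ball_subset_closedBall
  have hvi : Integrable v μ := (hvcont.integrable_of_hasCompactSupport hvs).restrict
  set p : ℂ → ℂ := fun z => u z - v z with hpdef
  have hpi : Integrable p μ := hui.sub hvi
  have hp0 : ∀ ζ, ‖ζ‖ < a → ∀ᵐ x ∂μ, p x = 0 ∨ a - ‖ζ‖ ≤ ‖id x - ζ‖ := by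
    intro ζ hζ
    refine Filter.Eventually.of_forall fun x => ?_
    by_cases hx : ‖x‖ ≤ a
    · left; simp [hpdef, hv, c3 x hx]
    · right
      push Not at hx
      have := norm_le_norm_sub_add x ζ
      simp only [id]
      linarith
  have hH : DifferentiableOn ℂ (fun ζ => ∫ x, p x / (id x - ζ) ∂μ) (Metric.ball 0 a) := by
    intro ζ hζ
    have hζ : ‖ζ‖ < a := by simpa using hζ
    exact (param_deriv measurable_id hpi (sub_pos.2 hζ) (hp0 ζ hζ)).differentiableAt.differentiableWithinAt
  have eq : ∀ ζ ∈ Metric.closedBall (0 : ℂ) r, cauchyGreen u ζ =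
      (π : ℂ)⁻¹ * pot v ζ + (-(π : ℂ)⁻¹) * ∫ x, p x / (id x - ζ) ∂μ := by
    intro ζ hζ
    have hζ : ‖ζ‖ < a := lt_of_le_of_lt (by simpa using hζ) hra
    have i1 : Integrable (fun ω => p ω / (ω - ζ)) μ :=
      param_int measurable_id hpi (sub_pos.2 hζ) (hp0 ζ hζ)
    have i2 : Integrable (fun ω => v ω / (ω - ζ)) := by
      refine (pot_integrable hvcont hvs ζ).neg.congr (Filter.Eventually.of_forall fun ω => ?_)
      simp only [Pi.neg_apply]
      rw [div_eq_mul_inv, ← neg_sub ζ ω, inv_neg]; ring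
    have e2 : ∫ ω, v ω / (ω - ζ) ∂μ = - pot v ζ := by
      rw [hμ, setIntegral_eq_integral_of_forall_compl_eq_zero, pot, ← integral_neg]
      · congr 1; ext ω
        rw [div_eq_mul_inv, ← neg_sub ζ ω, inv_neg]; ring
      · intro x hx
        rw [hv0 x, zero_div]
        simp only [unitDisc, Metric.mem_ball, dist_zero_right, not_lt] at hx
        linarith
    have e3 : ∫ ω, u ω / (ω - ζ) ∂μ = ∫ ω, v ω / (ω - ζ) ∂μ + ∫ ω, p ω / (ω - ζ) ∂μ := by
      rw [← integral_add i2.restrict i1]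
      congr 1; ext ω
      simp only [hpdef]; ring
    rw [cauchyGreen, e3, e2]
    simp only [id]
    ring
  refine holder_congr (holder_add hs ?_ ?_) eq
  · have := holder_mono hs (uniq_closedBall one_pos 0)
      (Metric.closedBall_subset_closedBall hr1.le) hp
    exact holder_clm hs this (ContinuousLinearMap.mul ℝ ℂ (π : ℂ)⁻¹)
  · exact holder_of_holo hα hα1 hr hra (hH.const_mul _)

theorem holder_conj {α : ℝ} {m : ℕ} {s : Set ℂ} (hs : UniqueDiffOn ℝ s) {f : ℂ → ℂ}
    (hf : HolderOn m α s f) : HolderOn m α s (fun x => (starRingEnd ℂ) (f x)) :=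
  holder_clm hs hf (Complex.conjCLE : ℂ →L[ℝ] ℂ)

theorem rhs_holder {α : ℝ} (hα : 0 < α) (hα1 : α < 1) {m n : ℕ} {r : ℝ} (hr : 0 < r)
    {B₁ B₂ : ℂ → Matrix (Fin n) (Fin n) ℂ} {w : ℂ → Fin n → ℂ}
    (hB₁ : ∀ i j, HolderOn m α (Metric.closedBall 0 r) (fun ζ => B₁ ζ i j))
    (hB₂ : ∀ i j, HolderOn m α (Metric.closedBall 0 r) (fun ζ => B₂ ζ i j))
    (hw : HolderOn m α (Metric.closedBall 0 r) w) (j : Fin n) :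
    HolderOn m α (Metric.closedBall 0 r)
      (fun ω => (B₁ ω *ᵥ w ω + B₂ ω *ᵥ vecConj (w ω)) j) := by
  have hs := uniq_closedBall hr 0
  rw [holder_pi hs] at hw
  have h1 := holder_sum hs Finset.univ (fun l _ => holder_mul hα hα1 hr (hB₁ j l) (hw l))
  have h2 := holder_sum hs Finset.univ
    (fun l _ => holder_mul hα hα1 hr (hB₂ j l) (holder_conj hs (hw l)))
  refine holder_congr (holder_add hs h1 h2) fun x _ => ?_
  simp [Matrix.mulVec, dotProduct, vecConj]

theorem interior_reg {α : ℝ} (hα : 0 < α) (hα1 : α < 1) {k n : ℕ}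
    {B₁ B₂ : ℂ → Matrix (Fin n) (Fin n) ℂ} {w φ : ℂ → Fin n → ℂ}
    (hB₁ : ∀ i j, HolderOn (k - 1) α (Metric.closedBall 0 1) (fun ζ => B₁ ζ i j))
    (hB₂ : ∀ i j, HolderOn (k - 1) α (Metric.closedBall 0 1) (fun ζ => B₂ ζ i j))
    (hw : HolderOn 0 α (Metric.closedBall 0 1) w)
    (hφ : DifferentiableOn ℂ φ unitDisc)
    (heq : ∀ ζ ∈ unitDisc,
      w ζ = cauchyGreenV (fun ω => B₁ ω *ᵥ w ω + B₂ ω *ᵥ vecConj (w ω)) ζ + φ ζ) (m : ℕ) :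
    m ≤ k → ∀ r : ℝ, 0 < r → r < 1 → HolderOn m α (Metric.closedBall 0 r) w := by
  induction m with
  | zero =>
    intro _ r hr hr1
    exact holder_mono (uniq_closedBall hr 0) (uniq_closedBall one_pos 0)
      (Metric.closedBall_subset_closedBall hr1.le) hw
  | succ m ih =>
    intro hm r hr hr1
    have hs := uniq_closedBall hr 0
    have hu := fun j => (rhs_holder hα hα1 one_pos
      (fun i j => holder_lower hα hα1 one_pos (Nat.zero_le _) (hB₁ i j))
      (fun i j => holder_lower hα hα1 one_pos (Nat.zero_le _) (hB₂ i j)) hw j).1.continuousOn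
    rw [holder_pi hs]
    intro j
    have h1 := interior_step hα hα1 (m := m) (hu j) (fun ρ hρ hρ1 => by
      have hb := fun (B : ℂ → Matrix (Fin n) (Fin n) ℂ) (hB : ∀ i j, HolderOn (k - 1) α
          (Metric.closedBall 0 1) (fun ζ => B ζ i j)) (i j : Fin n) =>
        holder_mono (uniq_closedBall hρ 0) (uniq_closedBall one_pos 0)
          (Metric.closedBall_subset_closedBall hρ1.le)
          (holder_lower hα hα1 one_pos (show m ≤ k - 1 by omega) (hB i j))
      exact rhs_holder hα hα1 hρ (hb B₁ hB₁) (hb B₂ hB₂) (ih (by omega) ρ hρ hρ1) j) r hr hr1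
    have h2 : HolderOn (m + 1) α (Metric.closedBall 0 r) (fun ζ => φ ζ j) :=
      holder_of_holo hα hα1 hr hr1 (differentiableOn_pi.1 hφ j)
    refine holder_congr (holder_add hs h1 h2) fun x hx => ?_
    have hx1 : x ∈ unitDisc := Metric.closedBall_subset_ball hr1 hx
    rw [heq x hx1]
    rfl

theorem w_reg {α : ℝ} (hα : 0 < α) {k n : ℕ} {w : ℂ → Fin n → ℂ}
    (hi : HolderOn k α (Metric.closedBall 0 (3 / 4)) w)
    (hann : HolderOn k α (Metric.closedBall 0 1 \ Metric.ball (0 : ℂ) (1 / 2)) w) :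
    HolderOn k α (Metric.closedBall 0 1) w := by
  obtain ⟨M, hM⟩ := bdd_of_holder hα hi (R := 3 / 4) (fun x hx => by simpa using hx)
  obtain ⟨M', hM'⟩ := bdd_of_holder hα hann (R := 1) (fun x hx => by simpa using hx.1)
  refine holder_glue (M := max M M') (δ := 1 / 8) hα (by norm_num) ?_ hi hann
    (fun x hx => (hM x hx).trans (le_max_left _ _)) (fun x hx => (hM' x hx).trans (le_max_right _ _))
  intro x _
  by_cases hx : ‖x‖ ≤ 5 / 8
  · left
    ext y
    simp only [Set.mem_inter_iff, Metric.mem_ball, mem_closedBall_zero_iff, dist_eq_norm]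
    refine and_congr_left fun hy => ?_
    have := norm_le_norm_sub_add y x
    constructor <;> intro <;> linarith
  · right
    push Not at hx
    ext y
    simp only [Set.mem_inter_iff, Metric.mem_ball, mem_closedBall_zero_iff, dist_eq_norm,
      Set.mem_sdiff, sub_zero, not_lt]
    refine and_congr_left fun hy => ?_
    have := norm_le_norm_sub_add x y
    rw [norm_sub_rev] at this
    constructor
    · intro h; exact ⟨h, by linarith⟩
    · exact fun h => h.1

end Part5

section Part6

theorem circ_lower {θ r : ℝ} (hθ : |θ| ≤ π) (hr : 0 ≤ r) (hr1 : r < 1) :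
    (|θ| + (1 - r)) / (2 * π) ≤ ‖Complex.exp (Complex.I * θ) - r‖ := by
  have hpi := Real.pi_gt_three
  have h1 : (1 - r) ≤ ‖Complex.exp (Complex.I * θ) - r‖ := by
    have := norm_sub_norm_le (Complex.exp (Complex.I * θ)) (r : ℂ)
    rw [mul_comm, Complex.norm_exp_ofReal_mul_I, Complex.norm_real, Real.norm_of_nonneg hr] at this
    rw [mul_comm]; exact this
  have h2 : ‖Complex.exp (Complex.I * θ) - 1‖ ≤ ‖Complex.exp (Complex.I * θ) - r‖ + (1 - r) := by
    have := norm_sub_le_norm_sub_add_norm_sub (Complex.exp (Complex.I * θ)) (r : ℂ) 1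
    have e : ‖(r : ℂ) - 1‖ = 1 - r := by
      rw [← Complex.ofReal_one, ← Complex.ofReal_sub, Complex.norm_real, Real.norm_eq_abs,
        abs_sub_comm, abs_of_nonneg (by linarith)]
    rwa [e] at this
  rw [Complex.norm_exp_I_mul_ofReal_sub_one, norm_mul, Real.norm_eq_abs, Real.norm_eq_abs,
    abs_two] at h2
  have h3 := Real.mul_abs_le_abs_sin (x := θ / 2) (by rw [abs_div, abs_two]; linarith)
  rw [abs_div, abs_two] at h3
  have h4 : 2 / π * |θ| ≤ 2 * |Real.sin (θ / 2)| := by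
    calc 2 / π * |θ| = 2 * (2 / π * (|θ| / 2)) := by ring
      _ ≤ _ := by gcongr
  have h5 : |θ| / π ≤ ‖Complex.exp (Complex.I * θ) - r‖ := by
    have : 2 / π * |θ| = 2 * (|θ| / π) := by ring
    linarith
  have h6 : (1 - r) / π ≤ ‖Complex.exp (Complex.I * θ) - r‖ := by
    refine le_trans ?_ h1
    apply div_le_self <;> linarith
  have : (|θ| + (1 - r)) / (2 * π) = (|θ| / π + (1 - r) / π) / 2 := by field_simp
  linarith

theorem circ_dist {ζ : ℂ} (hζ : ‖ζ‖ < 1) (θ : ℝ) : 1 - ‖ζ‖ ≤ ‖circleMap 0 1 θ - ζ‖ := by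
  have := norm_sub_norm_le (circleMap 0 1 θ) ζ
  simpa using this

theorem circ_cont (ζ : ℂ) (hζ : ‖ζ‖ < 1) (β : ℝ) :
    Continuous (fun θ => ‖circleMap 0 1 θ - ζ‖ ^ β) := by
  apply Continuous.rpow_const
  · exact ((continuous_circleMap 0 1).sub continuous_const).norm
  · intro θ; left
    have := circ_dist hζ θ
    linarith

theorem circ_int {α : ℝ} (hα1 : α < 1) : ∃ K : ℝ, 0 < K ∧ ∀ ζ : ℂ, ‖ζ‖ < 1 →
    ∫ θ in (0 : ℝ)..2 * π, ‖circleMap 0 1 θ - ζ‖ ^ (α - 2) ≤ K * (1 - ‖ζ‖) ^ (α - 1) := by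
  have hpi := Real.pi_pos
  refine ⟨(2 * π) ^ (2 - α) * (2 / (1 - α)), by have : 0 < 1 - α := by linarith
                                                positivity, fun ζ hζ => ?_⟩
  set r := ‖ζ‖ with hr
  set d := 1 - r with hd
  have hd0 : 0 < d := by linarith
  set t := Complex.arg ζ with ht
  have hper : Function.Periodic (fun θ => ‖circleMap 0 1 θ - ζ‖ ^ (α - 2)) (2 * π) := by
    intro θ; simp only [periodic_circleMap 0 1 θ]
  have e1 : ∫ θ in (0 : ℝ)..2 * π, ‖circleMap 0 1 θ - ζ‖ ^ (α - 2) =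
      ∫ θ in (-π)..π, ‖circleMap 0 1 (θ + t) - ζ‖ ^ (α - 2) := by
    rw [intervalIntegral.integral_comp_add_right (fun θ => ‖circleMap 0 1 θ - ζ‖ ^ (α - 2))]
    have := hper.intervalIntegral_add_eq 0 (-π + t)
    rw [zero_add] at this
    rw [this]; congr 1; ring
  have e2 : ∀ θ : ℝ, ‖circleMap 0 1 (θ + t) - ζ‖ = ‖Complex.exp (Complex.I * θ) - r‖ := by
    intro θ
    have : circleMap 0 1 (θ + t) - ζ =
        (Complex.exp (Complex.I * θ) - r) * Complex.exp (t * Complex.I) := by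
      rw [sub_mul, ht, hr, Complex.norm_mul_exp_arg_mul_I, ← Complex.exp_add]
      simp only [circleMap]
      push_cast
      simp only [zero_add, one_mul]
      congr 2; ring
    rw [this, norm_mul, Complex.norm_exp_ofReal_mul_I, mul_one]
  rw [e1]
  have hg : Continuous (fun θ : ℝ => (|θ| + d) ^ (α - 2)) := by
    apply Continuous.rpow_const (by fun_prop)
    intro θ; left; positivity
  have hs : ∫ θ in (-π)..π, (|θ| + d) ^ (α - 2) ≤ 2 / (1 - α) * d ^ (α - 1) := by
    have e3 : ∫ θ in (0:ℝ)..π, (|θ| + d) ^ (α - 2) ≤ 1 / (1 - α) * d ^ (α - 1) := by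
      have : ∫ θ in (0:ℝ)..π, (|θ| + d) ^ (α - 2) = ∫ θ in (0:ℝ)..π, (θ + d) ^ (α - 2) := by
        apply intervalIntegral.integral_congr
        intro θ hθ
        rw [Set.uIcc_of_le hpi.le] at hθ
        simp only [abs_of_nonneg hθ.1]
      rw [this, intervalIntegral.integral_comp_add_right (fun x => x ^ (α - 2)), integral_rpow]
      · have e : α - 2 + 1 = α - 1 := by ring
        rw [e, zero_add]
        have h1 : 0 ≤ (π + d) ^ (α - 1) := by positivity
        have h2 : 0 < 1 - α := by linarith
        rw [← neg_div_neg_eq, neg_sub, neg_sub, one_div, inv_mul_eq_div]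
        gcongr
        linarith
      · right
        refine ⟨by linarith, ?_⟩
        rw [Set.uIcc_of_le (by linarith)]
        intro h; linarith [h.1]
    have e4 : ∫ θ in (-π)..0, (|θ| + d) ^ (α - 2) = ∫ θ in (0:ℝ)..π, (|θ| + d) ^ (α - 2) := by
      have := intervalIntegral.integral_comp_neg (a := 0) (b := π)
        (fun θ => (|θ| + d) ^ (α - 2))
      simp only [abs_neg, neg_zero] at this
      exact this.symm
    rw [← intervalIntegral.integral_add_adjacent_intervals (b := 0)
      (hg.intervalIntegrable _ _) (hg.intervalIntegrable _ _), e4]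
    have : 2 / (1 - α) * d ^ (α - 1) = 1 / (1 - α) * d ^ (α - 1) + 1 / (1 - α) * d ^ (α - 1) := by
      ring
    linarith
  calc ∫ θ in (-π)..π, ‖circleMap 0 1 (θ + t) - ζ‖ ^ (α - 2)
      ≤ ∫ θ in (-π)..π, (2 * π) ^ (2 - α) * (|θ| + d) ^ (α - 2) := by
        apply intervalIntegral.integral_mono_on (by linarith)
        · exact ((circ_cont ζ hζ _).comp (continuous_add_const t)).intervalIntegrable _ _
        · exact (continuous_const.mul hg).intervalIntegrable _ _
        · intro θ hθ
          rw [e2]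
          have h1 := circ_lower (abs_le.2 hθ) (norm_nonneg ζ) hζ
          have h2 : 0 < |θ| + d := by positivity
          calc _ ≤ ((|θ| + d) / (2 * π)) ^ (α - 2) :=
                Real.rpow_le_rpow_of_nonpos (by positivity) h1 (by linarith)
            _ = _ := by
              rw [Real.div_rpow h2.le (by positivity), div_eq_mul_inv, mul_comm,
                ← Real.rpow_neg (by positivity), neg_sub]
    _ ≤ _ := by
        rw [intervalIntegral.integral_const_mul, mul_assoc]
        gcongr

noncomputable def cint (g : ℂ → ℂ) (ζ : ℂ) : ℂ :=
  (2 * π * Complex.I)⁻¹ * ∮ ω in C(0, 1), g ω / (ω - ζ)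

theorem circ_comp {g : ℂ → ℂ} (hg : ContinuousOn g (Metric.closedBall 0 1)) :
    Continuous (fun θ => g (circleMap 0 1 θ)) := by
  rw [← continuousOn_univ]
  refine hg.comp (continuous_circleMap 0 1).continuousOn fun θ _ => ?_
  simp

theorem cint_deriv {g : ℂ → ℂ} (hg : ContinuousOn g (Metric.closedBall 0 1)) {ζ : ℂ}
    (hζ : ‖ζ‖ < 1) :
    HasDerivAt (cint g) ((2 * π * Complex.I)⁻¹ * ∮ ω in C(0, 1), g ω / (ω - ζ) ^ 2) ζ := by
  have hpi := Real.pi_pos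
  have key : ∀ n : ℕ, ∀ z : ℂ, ∮ ω in C(0, 1), g ω / (ω - z) ^ n =
      ∫ θ in Set.Ioc 0 (2 * π), (circleMap 0 1 θ * Complex.I * g (circleMap 0 1 θ)) /
        (circleMap 0 1 θ - z) ^ n := by
    intro n z
    rw [circleIntegral, intervalIntegral.integral_of_le (by positivity)]
    simp only [deriv_circleMap, smul_eq_mul, mul_div_assoc]
  have h1 := param_deriv (μ := volume.restrict (Set.Ioc 0 (2 * π))) (G := circleMap 0 1)
    (p := fun θ => circleMap 0 1 θ * Complex.I * g (circleMap 0 1 θ)) (ζ₀ := ζ) (d := 1 - ‖ζ‖)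
    (continuous_circleMap 0 1).measurable ?_ (by linarith)
    (Filter.Eventually.of_forall fun θ => Or.inr (circ_dist hζ θ))
  · rw [← key] at h1
    have h2 := h1.const_mul (2 * π * Complex.I)⁻¹
    refine h2.congr_of_eventuallyEq (Filter.Eventually.of_forall fun z => ?_)
    have := key 1 z
    simp only [pow_one] at this
    simp only [cint, this]
  · have : Continuous (fun θ => circleMap 0 1 θ * Complex.I * g (circleMap 0 1 θ)) :=
      ((continuous_circleMap 0 1).mul continuous_const).mul (circ_comp hg)
    exact (this.intervalIntegrable 0 (2 * π)).1

theorem circ_integrable {h : ℂ → ℂ} (hc : Continuous (fun θ => h (circleMap 0 1 θ))) :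
    CircleIntegrable h 0 1 := hc.intervalIntegrable _ _

theorem circ_div {h : ℂ → ℂ} (hc : Continuous (fun θ => h (circleMap 0 1 θ))) {ζ : ℂ}
    (hζ : ‖ζ‖ < 1) (n : ℕ) :
    Continuous (fun θ => h (circleMap 0 1 θ) / (circleMap 0 1 θ - ζ) ^ n) := by
  apply hc.div (((continuous_circleMap 0 1).sub continuous_const).pow n)
  intro θ
  apply pow_ne_zero
  rw [← norm_pos_iff]
  have := circ_dist hζ θ
  change 0 < ‖circleMap 0 1 θ - ζ‖
  linarith

theorem cint_deriv_bound {α : ℝ} (hα : 0 < α) (hα1 : α < 1) {g : ℂ → ℂ}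
    (hg : HolderOn 0 α (Metric.closedBall 0 1) g) : ∃ M : ℝ, 0 < M ∧ ∀ ζ : ℂ, ‖ζ‖ < 1 →
      ‖deriv (cint g) ζ‖ ≤ M * (1 - ‖ζ‖) ^ (α - 1) := by
  obtain ⟨hgc, H, hH, hb⟩ := holder_zero_iff.1 hg
  obtain ⟨K, hK, hKb⟩ := circ_int hα1
  have hpi := Real.pi_pos
  refine ⟨(2 * π)⁻¹ * (H * K), by positivity, fun ζ hζ => ?_⟩
  rw [(cint_deriv hgc hζ).deriv]
  have e1 : ∮ ω in C(0, 1), g ω / (ω - ζ) ^ 2 = ∮ ω in C(0, 1), (g ω - g ζ) / (ω - ζ) ^ 2 := by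
    simp only [sub_div]
    rw [circleIntegral.integral_sub]
    · have : ∮ ω in C(0, 1), g ζ / (ω - ζ) ^ 2 = 0 := by
        have h := circleIntegral.integral_sub_zpow_of_ne (n := -2) (by norm_num) 0 ζ 1
        simp only [div_eq_mul_inv, circleIntegral.integral_const_mul]
        rw [mul_eq_zero]; right
        exact h
      rw [this, sub_zero]
    · exact circ_integrable (circ_div (circ_comp hgc) hζ 2)
    · exact circ_integrable (circ_div (h := fun _ => g ζ) continuous_const hζ 2)
  have e2 : ‖(2 * π * Complex.I : ℂ)⁻¹‖ = (2 * π)⁻¹ := by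
    simp [abs_of_pos hpi]
  rw [e1, norm_mul, e2, mul_assoc]
  gcongr
  rw [circleIntegral]
  calc _ ≤ ∫ θ in (0:ℝ)..2 * π, H * ‖circleMap 0 1 θ - ζ‖ ^ (α - 2) := by
        apply intervalIntegral.norm_integral_le_of_norm_le (by positivity)
        · refine Filter.Eventually.of_forall fun θ _ => ?_
          have h0 : 0 < ‖circleMap 0 1 θ - ζ‖ := by
            have := circ_dist hζ θ
            linarith
          have h1 := hb (circleMap 0 1 θ) (by simp) ζ (by simpa using hζ.le)
          rw [norm_smul, deriv_circleMap, norm_div, norm_pow]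
          simp only [norm_mul, norm_circleMap_zero, abs_one, Complex.norm_I, mul_one, one_mul]
          rw [div_le_iff₀ (by positivity), mul_assoc, ← Real.rpow_natCast, ← Real.rpow_add h0]
          have e : α - 2 + ((2 : ℕ) : ℝ) = α := by push_cast; ring
          rw [e]; exact h1
        · exact (continuous_const.mul (circ_cont ζ hζ _)).intervalIntegrable _ _
    _ ≤ _ := by
        rw [intervalIntegral.integral_const_mul, mul_assoc]
        gcongr
        exact hKb ζ hζ

end Part6

section Part7

theorem hl_radial {α M : ℝ} (hα : 0 < α) (hα1 : α < 1) (hM : 0 < M) {F : ℂ → ℂ}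
    (hF : ∀ ζ : ℂ, ‖ζ‖ < 1 → HasDerivAt F (deriv F ζ) ζ)
    (hb : ∀ ζ : ℂ, ‖ζ‖ < 1 → ‖deriv F ζ‖ ≤ M * (1 - ‖ζ‖) ^ (α - 1)) {a : ℂ} (ha : ‖a‖ < 1)
    {δ : ℝ} (hδ : 0 ≤ δ) (hδ1 : δ ≤ 1) :
    ‖F a - F (((1 - δ : ℝ) : ℂ) * a)‖ ≤ M / α * δ ^ α := by
  have hn : ∀ t ∈ Set.Icc (1 - δ) 1, ‖((t : ℝ) : ℂ) * a‖ < 1 := by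
    intro t ht
    rw [norm_mul, Complex.norm_real, Real.norm_of_nonneg (by linarith [ht.1])]
    nlinarith [ht.1, ht.2, norm_nonneg a]
  have hd : ∀ t ∈ Set.Icc (1 - δ) 1,
      HasDerivAt (fun t : ℝ => F ((t : ℂ) * a) - F (((1 - δ : ℝ) : ℂ) * a))
        (deriv F ((t : ℂ) * a) * a) t := by
    intro t ht
    have h1 : HasDerivAt (fun s : ℝ => (s : ℂ) * a) a t := by
      have := (Complex.ofRealCLM.hasDerivAt (x := t)).mul_const a
      simpa using this
    have h2 := (hF _ (hn t ht)).comp t h1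
    exact h2.sub_const _
  have key := image_norm_le_of_norm_deriv_right_le_deriv_boundary'
    (f := fun t : ℝ => F ((t : ℂ) * a) - F (((1 - δ : ℝ) : ℂ) * a)) (a := 1 - δ) (b := 1)
    (f' := fun t => deriv F ((t : ℂ) * a) * a)
    (B := fun t => M / α * (δ ^ α - (1 - t) ^ α)) (B' := fun t => M * (1 - t) ^ (α - 1))
    (fun t ht => (hd t ht).continuousAt.continuousWithinAt)
    (fun t ht => (hd t ⟨ht.1, ht.2.le⟩).hasDerivWithinAt) (by simp) ?_ ?_ ?_
    (x := 1) ⟨by linarith, le_rfl⟩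
  · simpa [Real.zero_rpow hα.ne'] using key
  · apply Continuous.continuousOn
    refine continuous_const.mul (continuous_const.sub ?_)
    exact (continuous_const.sub continuous_id).rpow_const fun t => Or.inr hα.le
  · intro t ht
    have h0 : 0 < 1 - t := by linarith [ht.2]
    have h1 : HasDerivAt (fun t : ℝ => 1 - t) (-1) t := by
      simpa using (hasDerivAt_id t).const_sub 1
    have h2 := h1.rpow_const (p := α) (Or.inl h0.ne')
    have h3 := (h2.const_sub (δ ^ α)).const_mul (M / α)
    refine (h3.congr_deriv ?_).hasDerivWithinAt
    field_simp
  · intro t ht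
    have ht' : t ∈ Set.Icc (1 - δ) 1 := ⟨ht.1, ht.2.le⟩
    have h0 : 0 < 1 - t := by linarith [ht.2]
    have h2 : 1 - t ≤ 1 - ‖(t : ℂ) * a‖ := by
      rw [norm_mul, Complex.norm_real, Real.norm_of_nonneg (by linarith [ht.1])]
      nlinarith [ht.1, ht.2, norm_nonneg a]
    rw [norm_mul]
    calc _ ≤ ‖deriv F ((t : ℂ) * a)‖ * 1 := by gcongr
      _ ≤ M * (1 - ‖(t : ℂ) * a‖) ^ (α - 1) := by rw [mul_one]; exact hb _ (hn t ht')
      _ ≤ _ := by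
        have := Real.rpow_le_rpow_of_nonpos h0 h2 (z := α - 1) (by linarith)
        gcongr

theorem hardy_littlewood {α M : ℝ} (hα : 0 < α) (hα1 : α < 1) (hM : 0 < M) {F : ℂ → ℂ}
    (hF : ∀ ζ : ℂ, ‖ζ‖ < 1 → HasDerivAt F (deriv F ζ) ζ)
    (hb : ∀ ζ : ℂ, ‖ζ‖ < 1 → ‖deriv F ζ‖ ≤ M * (1 - ‖ζ‖) ^ (α - 1)) {a b : ℂ} (ha : ‖a‖ < 1)
    (hb' : ‖b‖ < 1) : ‖F a - F b‖ ≤ (2 * (M / α) + M) * ‖a - b‖ ^ α := by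
  have tri : ∀ x y : ℂ, ‖F a - F b‖ ≤ ‖F a - x‖ + ‖x - y‖ + ‖F b - y‖ := by
    intro x y
    have : F a - F b = (F a - x) + (x - y) - (F b - y) := by ring
    rw [this]
    exact (norm_sub_le _ _).trans (by gcongr; exact norm_add_le _ _)
  rcases le_total 1 ‖a - b‖ with h | h
  · have h1 := hl_radial hα hα1 hM hF hb ha zero_le_one le_rfl
    have h2 := hl_radial hα hα1 hM hF hb hb' zero_le_one le_rfl
    simp only [sub_self, Complex.ofReal_zero, zero_mul, Real.one_rpow, mul_one] at h1 h2
    have h3 := tri (F 0) (F 0)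
    have h4 : 1 ≤ ‖a - b‖ ^ α := Real.one_le_rpow h hα.le
    have h5 : 0 < M / α := by positivity
    rw [sub_self, norm_zero] at h3
    nlinarith
  · rcases eq_or_ne a b with rfl | hab
    · simp only [sub_self, norm_zero]; positivity
    set δ := ‖a - b‖ with hδ
    have hδ0 : 0 < δ := norm_pos_iff.2 (sub_ne_zero.2 hab)
    have h1 := hl_radial hα hα1 hM hF hb ha hδ0.le h
    have h2 := hl_radial hα hα1 hM hF hb hb' hδ0.le h
    have hm : ∀ x : ℂ, ‖x‖ < 1 → ((1 - δ : ℝ) : ℂ) * x ∈ Metric.closedBall (0 : ℂ) (1 - δ) := by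
      intro x hx
      rw [mem_closedBall_zero_iff, norm_mul, Complex.norm_real,
        Real.norm_of_nonneg (by linarith)]
      nlinarith [norm_nonneg x]
    have h3 := Convex.norm_image_sub_le_of_norm_hasDerivWithin_le (f := F) (f' := deriv F)
      (s := Metric.closedBall (0 : ℂ) (1 - δ)) (C := M * δ ^ (α - 1))
      (fun x hx => (hF x (by rw [mem_closedBall_zero_iff] at hx; linarith)).hasDerivWithinAt)
      (fun x hx => by
        rw [mem_closedBall_zero_iff] at hx
        refine (hb x (by linarith)).trans ?_
        have := Real.rpow_le_rpow_of_nonpos hδ0 (y := 1 - ‖x‖) (z := α - 1)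
          (by linarith) (by linarith)
        gcongr) (convex_closedBall _ _) (hm b hb') (hm a ha)
    have h4 : ‖((1 - δ : ℝ) : ℂ) * a - ((1 - δ : ℝ) : ℂ) * b‖ ≤ δ := by
      rw [← mul_sub, norm_mul, Complex.norm_real, Real.norm_of_nonneg (by linarith)]
      nlinarith
    have h5 : M * δ ^ (α - 1) * ‖((1 - δ : ℝ) : ℂ) * a - ((1 - δ : ℝ) : ℂ) * b‖ ≤ M * δ ^ α := by
      calc _ ≤ M * δ ^ (α - 1) * δ := by gcongr
        _ = _ := by
          rw [mul_assoc, ← Real.rpow_add_one hδ0.ne']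
          congr 2; ring
    have h6 := tri (F (((1 - δ : ℝ) : ℂ) * a)) (F (((1 - δ : ℝ) : ℂ) * b))
    have h7 : (2 * (M / α) + M) * δ ^ α = M / α * δ ^ α + M * δ ^ α + M / α * δ ^ α := by ring
    linarith

theorem holder_ext_closed {α C : ℝ} (hα : 0 < α) {F : ℂ → ℂ}
    (h : ∀ a b : ℂ, ‖a‖ < 1 → ‖b‖ < 1 → ‖F a - F b‖ ≤ C * ‖a - b‖ ^ α) :
    ∃ G : ℂ → ℂ, (∀ ζ : ℂ, ‖ζ‖ < 1 → G ζ = F ζ) ∧ HolderOn 0 α (Metric.closedBall 0 1) G := by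
  have hcl : closure (Metric.ball (0 : ℂ) 1) = Metric.closedBall 0 1 :=
    closure_ball _ one_ne_zero
  have hH := (holder_zero_iff.1 (holder_zero_of (s := Metric.ball (0 : ℂ) 1) hα fun x hx y hy =>
    h x y (by simpa using hx) (by simpa using hy))).1
  have huc : UniformContinuousOn F (Metric.ball (0 : ℂ) 1) := by
    rw [Metric.uniformContinuousOn_iff]
    intro ε hε
    have h0 : Filter.Tendsto (fun t : ℝ => C * t ^ α) (nhds 0) (nhds 0) := by
      have : Continuous (fun t : ℝ => C * t ^ α) :=
        continuous_const.mul (continuous_id.rpow_const fun t => Or.inr hα.le)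
      simpa [Real.zero_rpow hα.ne'] using this.tendsto 0
    obtain ⟨δ, hδ, hδ'⟩ := Metric.eventually_nhds_iff.1 (h0.eventually (gt_mem_nhds hε))
    refine ⟨δ, hδ, fun a ha b hb hab => ?_⟩
    rw [dist_eq_norm] at hab ⊢
    refine (h a b (by simpa using ha) (by simpa using hb)).trans_lt (hδ' ?_)
    rw [Real.dist_eq, sub_zero, abs_of_nonneg (norm_nonneg _)]
    exact hab
  have hlim : ∀ x ∈ Metric.closedBall (0 : ℂ) 1, ∃ y, Filter.Tendsto F
      (nhdsWithin x (Metric.ball 0 1)) (nhds y) := by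
    intro x hx
    rw [← hcl, mem_closure_iff_nhdsWithin_neBot] at hx
    have hc : Cauchy (Filter.map F (nhdsWithin x (Metric.ball 0 1))) := by
      have h1 : Cauchy (nhdsWithin x (Metric.ball (0 : ℂ) 1)) :=
        (cauchy_nhds (a := x)).mono nhdsWithin_le_nhds
      refine ⟨h1.1.map F, ?_⟩
      rw [Filter.prod_map_map_eq]
      refine Filter.Tendsto.mono_left huc ?_
      refine le_inf h1.2 ?_
      rw [← Filter.prod_principal_principal]
      exact Filter.prod_mono inf_le_right inf_le_right
    exact CompleteSpace.complete hc
  refine ⟨extendFrom (Metric.ball 0 1) F, fun ζ hζ => ?_, ?_⟩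
  · have hζ' : ζ ∈ Metric.ball (0 : ℂ) 1 := by simpa using hζ
    exact extendFrom_eq (subset_closure hζ') (hH ζ hζ')
  · apply holder_zero_of (C := C) hα
    intro x hx y hy
    have tx := tendsto_extendFrom (hlim x hx)
    have ty := tendsto_extendFrom (hlim y hy)
    have : (nhdsWithin x (Metric.ball (0 : ℂ) 1)).NeBot := by
      rwa [← hcl, mem_closure_iff_nhdsWithin_neBot] at hx
    have : (nhdsWithin y (Metric.ball (0 : ℂ) 1)).NeBot := by
      rwa [← hcl, mem_closure_iff_nhdsWithin_neBot] at hy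
    have t1 := ((tx.comp Filter.tendsto_fst).sub (ty.comp Filter.tendsto_snd)).norm
    have t2 : Filter.Tendsto (fun p : ℂ × ℂ => C * ‖p.1 - p.2‖ ^ α)
        ((nhdsWithin x (Metric.ball (0 : ℂ) 1)) ×ˢ (nhdsWithin y (Metric.ball (0 : ℂ) 1)))
        (nhds (C * ‖x - y‖ ^ α)) := by
      have : Continuous (fun p : ℂ × ℂ => C * ‖p.1 - p.2‖ ^ α) :=
        continuous_const.mul ((continuous_fst.sub continuous_snd).norm.rpow_const
          fun t => Or.inr hα.le)
      refine (this.tendsto (x, y)).mono_left ?_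
      rw [nhds_prod_eq]
      exact Filter.prod_mono nhdsWithin_le_nhds nhdsWithin_le_nhds
    refine le_of_tendsto_of_tendsto t1 t2 ?_
    have m1 : ∀ᶠ p in (nhdsWithin x (Metric.ball (0 : ℂ) 1)) ×ˢ
        (nhdsWithin y (Metric.ball (0 : ℂ) 1)),
        p.1 ∈ Metric.ball (0 : ℂ) 1 ∧ p.2 ∈ Metric.ball (0 : ℂ) 1 :=
      Filter.Eventually.prod_mk self_mem_nhdsWithin self_mem_nhdsWithin
    filter_upwards [m1] with p hp
    exact h p.1 p.2 (by simpa using hp.1) (by simpa using hp.2)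

theorem privalov_zero {α : ℝ} (hα : 0 < α) (hα1 : α < 1) {g : ℂ → ℂ}
    (hg : HolderOn 0 α (Metric.closedBall 0 1) g) :
    ∃ G : ℂ → ℂ, (∀ ζ : ℂ, ‖ζ‖ < 1 → G ζ = cint g ζ) ∧
      HolderOn 0 α (Metric.closedBall 0 1) G := by
  obtain ⟨M, hM, hb⟩ := cint_deriv_bound hα hα1 hg
  exact holder_ext_closed hα fun a b ha hb' => hardy_littlewood hα hα1 hM
    (fun ζ hζ => (cint_deriv (holder_zero_iff.1 hg).1 hζ).differentiableAt.hasDerivAt) hb ha hb'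

end Part7

section Part8

noncomputable def tder (g : ℂ → ℂ) (ω : ℂ) : ℂ :=
  -Complex.I * (starRingEnd ℂ) ω *
    (fderivWithin ℝ g (Metric.closedBall 0 1) ω (Complex.I * ω))

theorem tder_holder {α : ℝ} (hα : 0 < α) (hα1 : α < 1) {k : ℕ} {g : ℂ → ℂ}
    (hg : HolderOn (k + 1) α (Metric.closedBall 0 1) g) :
    HolderOn k α (Metric.closedBall 0 1) (tder g) := by
  have hs := uniq_closedBall one_pos (0 : ℂ)
  have hL : ∀ L : ℂ →L[ℝ] ℂ, HolderOn k α (Metric.closedBall 0 1) (fun ω => L ω) := fun L =>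
    holder_of_contDiffOn hα hα1 one_pos L.contDiff.contDiffOn
  have h1 := holder_succ_apply hs hg 1
  have h2 := holder_succ_apply hs hg Complex.I
  have a1 := hL (Complex.ofRealCLM.comp (-Complex.imCLM))
  have a2 := hL (Complex.ofRealCLM.comp Complex.reCLM)
  have a3 := hL (Complex.conjCLE : ℂ →L[ℝ] ℂ)
  have a4 := holder_mul hα hα1 one_pos (holder_const (-Complex.I)) a3
  have a5 := holder_mul hα hα1 one_pos a4
    (holder_add hs (holder_mul hα hα1 one_pos a1 h1) (holder_mul hα hα1 one_pos a2 h2))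
  refine holder_congr a5 fun ω _ => ?_
  unfold tder
  rw [lin2_of (fderivWithin ℝ g (Metric.closedBall 0 1) ω)]
  simp [lin2]

theorem cint_tder {α : ℝ} (hα : 0 < α) (hα1 : α < 1) {g : ℂ → ℂ}
    (hg : HolderOn 1 α (Metric.closedBall 0 1) g) {ζ : ℂ} (hζ : ‖ζ‖ < 1) :
    HasDerivAt (cint g) (cint (tder g) ζ) ζ := by
  have hs := uniq_closedBall one_pos (0 : ℂ)
  have hgc : ContinuousOn g (Metric.closedBall 0 1) := hg.1.continuousOn
  have htc : ContinuousOn (tder g) (Metric.closedBall 0 1) :=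
    (tder_holder (k := 0) hα hα1 hg).1.continuousOn
  refine (cint_deriv hgc hζ).congr_deriv ?_
  unfold cint
  congr 1
  rw [circleIntegral, circleIntegral]
  simp only [deriv_circleMap, smul_eq_mul]
  have hd : ∀ θ : ℝ, HasDerivAt (fun θ => g (circleMap 0 1 θ) / (circleMap 0 1 θ - ζ))
      (circleMap 0 1 θ * Complex.I * (tder g (circleMap 0 1 θ) / (circleMap 0 1 θ - ζ)) -
       circleMap 0 1 θ * Complex.I * (g (circleMap 0 1 θ) / (circleMap 0 1 θ - ζ) ^ 2)) θ := by
    intro θ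
    have hne : circleMap 0 1 θ - ζ ≠ 0 := by
      rw [← norm_pos_iff]
      have := circ_dist hζ θ
      linarith
    have hm : circleMap 0 1 θ ∈ Metric.closedBall (0 : ℂ) 1 := by simp
    have h1 := ((hg.1.differentiableOn (by norm_num)) _ hm).hasFDerivWithinAt
    have h2 : HasDerivAt (fun θ => g (circleMap 0 1 θ))
        (fderivWithin ℝ g (Metric.closedBall 0 1) (circleMap 0 1 θ)
          (circleMap 0 1 θ * Complex.I)) θ := by
      have := h1.comp_hasDerivWithinAt (s := Set.univ) θ
        (hasDerivAt_circleMap 0 1 θ).hasDerivWithinAt (fun θ _ => by simp)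
      rwa [hasDerivWithinAt_univ] at this
    have h3 := h2.div ((hasDerivAt_circleMap 0 1 θ).sub_const ζ) hne
    refine h3.congr_deriv ?_
    have hcc : circleMap 0 1 θ * (starRingEnd ℂ) (circleMap 0 1 θ) = 1 := by
      rw [Complex.mul_conj, Complex.normSq_eq_norm_sq]; simp
    have e : fderivWithin ℝ g (Metric.closedBall 0 1) (circleMap 0 1 θ)
          (circleMap 0 1 θ * Complex.I) =
        circleMap 0 1 θ * Complex.I * tder g (circleMap 0 1 θ) := by
      unfold tder
      rw [mul_comm (circleMap 0 1 θ) Complex.I]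
      set X := fderivWithin ℝ g (Metric.closedBall 0 1) (circleMap 0 1 θ)
          (Complex.I * circleMap 0 1 θ)
      linear_combination (-X) * hcc +
        circleMap 0 1 θ * (starRingEnd ℂ) (circleMap 0 1 θ) * X * Complex.I_sq
    rw [e]
    field_simp
  have hper := intervalIntegral.integral_eq_sub_of_hasDerivAt (a := 0) (b := 2 * π)
    (fun θ _ => hd θ)
  have c1 : Continuous (fun θ => circleMap 0 1 θ * Complex.I *
      (tder g (circleMap 0 1 θ) / (circleMap 0 1 θ - ζ))) := by
    have := circ_div (circ_comp htc) hζ 1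
    simp only [pow_one] at this
    exact ((continuous_circleMap 0 1).mul continuous_const).mul this
  have c2 : Continuous (fun θ => circleMap 0 1 θ * Complex.I *
      (g (circleMap 0 1 θ) / (circleMap 0 1 θ - ζ) ^ 2)) :=
    ((continuous_circleMap 0 1).mul continuous_const).mul (circ_div (circ_comp hgc) hζ 2)
  have hz := hper ((c1.sub c2).intervalIntegrable _ _)
  rw [intervalIntegral.integral_sub (c1.intervalIntegrable _ _) (c2.intervalIntegrable _ _)] at hz
  have e0 : circleMap 0 1 (2 * π) = circleMap 0 1 0 := by
    simpa using periodic_circleMap 0 1 0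
  rw [e0, sub_self, sub_eq_zero] at hz
  exact hz.symm

theorem privalov {α : ℝ} (hα : 0 < α) (hα1 : α < 1) {k : ℕ} : ∀ {g : ℂ → ℂ},
    HolderOn k α (Metric.closedBall 0 1) g →
    ∃ G : ℂ → ℂ, (∀ ζ : ℂ, ‖ζ‖ < 1 → G ζ = cint g ζ) ∧
      HolderOn k α (Metric.closedBall 0 1) G := by
  have hs := uniq_closedBall one_pos (0 : ℂ)
  have hcl : closure (Metric.ball (0 : ℂ) 1) = Metric.closedBall 0 1 :=
    closure_ball _ one_ne_zero
  induction k with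
  | zero => exact fun hg => privalov_zero hα hα1 hg
  | succ k ih =>
    intro g hg
    obtain ⟨G, hG, hGh⟩ := privalov_zero hα hα1
      (holder_lower (m := 0) hα hα1 one_pos (by omega) hg)
    obtain ⟨G1, hG1, hG1h⟩ := ih (tder_holder hα hα1 hg)
    refine ⟨G, hG, ?_⟩
    have hI : HolderOn k α (Metric.closedBall 0 1) (fun x => Complex.I * G1 x) :=
      holder_mul hα hα1 one_pos (holder_const Complex.I) hG1h
    refine holder_succ_of hs hG1h hI ?_
    have hd : ∀ x ∈ Metric.ball (0 : ℂ) 1, HasFDerivAt G (lin2 (G1 x) (Complex.I * G1 x)) x := by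
      intro x hx
      have hx' : ‖x‖ < 1 := by simpa using hx
      have h1 := cint_tder hα hα1 (holder_lower (m := 1) hα hα1 one_pos (by omega) hg) hx'
      have h2 : HasDerivAt G (cint (tder g) x) x := by
        refine h1.congr_of_eventuallyEq ?_
        filter_upwards [Metric.isOpen_ball.mem_nhds hx] with y hy
        exact hG y (by simpa using hy)
      rw [← hG1 x hx'] at h2
      have h3 := h2.hasFDerivAt.restrictScalars ℝ
      rw [lin2_of (ContinuousLinearMap.restrictScalars ℝ _)] at h3
      simpa using h3
    intro x hx
    rw [← hcl]
    refine hasFDerivWithinAt_closure_of_tendsto_fderiv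
      (fun y hy => (hd y hy).differentiableAt.differentiableWithinAt)
      (convex_ball _ _) Metric.isOpen_ball ?_ ?_
    · intro y hy
      rw [hcl] at hy
      exact ((holder_zero_iff.1 hGh).1 y hy).mono Metric.ball_subset_closedBall
    · have hc := (lin2_of_holder hs hG1h hI).1.continuousOn x hx
      have hc' := (hc.mono Metric.ball_subset_closedBall).tendsto
      refine hc'.congr' ?_
      filter_upwards [self_mem_nhdsWithin] with y hy
      exact (hd y hy).fderiv.symm

end Part8

section Part9

theorem disc_inv : ∃ K : ℝ, ∀ ζ ∈ Metric.closedBall (0 : ℂ) 1,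
    IntegrableOn (fun ω : ℂ => ‖ω - ζ‖⁻¹) unitDisc ∧ ∫ ω in unitDisc, ‖ω - ζ‖⁻¹ ≤ K := by
  set h : ℂ → ℝ := (Metric.closedBall (0 : ℂ) 2).indicator (fun z => ‖z‖⁻¹) with hh
  have hi : Integrable h := by
    rw [hh, integrable_indicator_iff Metric.isClosed_closedBall.measurableSet]
    have := (inv_locInt.integrableOn_isCompact (isCompact_closedBall (0 : ℂ) 2)).norm
    simp only [norm_inv] at this
    exact this
  have hpos : ∀ z, 0 ≤ h z := fun z => Set.indicator_nonneg (fun _ _ => by positivity) z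
  refine ⟨∫ z, h z, fun ζ hζ => ?_⟩
  have hsh : Integrable (fun ω => h (ω - ζ)) := hi.comp_sub_right ζ
  have hle : ∀ ω ∈ unitDisc, ‖ω - ζ‖⁻¹ = h (ω - ζ) := by
    intro ω hω
    have h1 : ‖ω‖ < 1 := by simpa [unitDisc] using hω
    have h2 : ‖ζ‖ ≤ 1 := by simpa using hζ
    rw [hh, Set.indicator_of_mem]
    rw [mem_closedBall_zero_iff]
    exact (norm_sub_le _ _).trans (by linarith)
  have hm : MeasurableSet unitDisc := Metric.isOpen_ball.measurableSet
  refine ⟨hsh.integrableOn.congr_fun (fun ω hω => (hle ω hω).symm) hm, ?_⟩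
  rw [setIntegral_congr_fun hm hle, ← integral_sub_right_eq_self h ζ]
  exact setIntegral_le_integral hsh (Filter.Eventually.of_forall fun ω => hpos _)

theorem disc_bdd {u : ℂ → ℂ} (hu : ContinuousOn u (Metric.closedBall 0 1)) :
    ∃ M : ℝ, 0 < M ∧ ∀ ω ∈ Metric.closedBall (0 : ℂ) 1, ‖u ω‖ ≤ M := by
  obtain ⟨M, hM⟩ := (isCompact_closedBall (0 : ℂ) 1).exists_bound_of_continuousOn hu
  exact ⟨max M 1, by positivity, fun ω hω => (hM ω hω).trans (le_max_left _ _)⟩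

theorem disc_meas {u : ℂ → ℂ} (hu : ContinuousOn u (Metric.closedBall 0 1)) :
    AEStronglyMeasurable u (volume.restrict unitDisc) :=
  (hu.mono Metric.ball_subset_closedBall).aestronglyMeasurable Metric.isOpen_ball.measurableSet

theorem disc_ker_int {u : ℂ → ℂ} (hu : ContinuousOn u (Metric.closedBall 0 1)) {ζ : ℂ}
    (hζ : ζ ∈ Metric.closedBall (0 : ℂ) 1) :
    IntegrableOn (fun ω => u ω / (ω - ζ)) unitDisc := by
  obtain ⟨K, hK⟩ := disc_inv
  obtain ⟨M, hM, hMb⟩ := disc_bdd hu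
  refine ((hK ζ hζ).1.const_mul M).mono' ?_ ?_
  · simp only [div_eq_mul_inv]
    exact (disc_meas hu).mul (measurable_id.sub measurable_const).inv.aestronglyMeasurable
  · filter_upwards [ae_restrict_mem Metric.isOpen_ball.measurableSet] with ω hω
    rw [norm_div, div_eq_mul_inv]
    have := hMb ω (Metric.ball_subset_closedBall hω)
    gcongr

theorem cg_holder {u : ℂ → ℂ} (hu : ContinuousOn u (Metric.closedBall 0 1)) :
    HolderOn 0 (1 / 2) (Metric.closedBall 0 1) (cauchyGreen u) := by
  obtain ⟨C, hC, hk⟩ := ker_bound (α := 1 / 2) (by norm_num) (by norm_num)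
  obtain ⟨M, hM, hMb⟩ := disc_bdd hu
  have hpi := Real.pi_pos
  apply holder_zero_of (C := π⁻¹ * (M * 2 * C)) (by norm_num)
  intro x hx y hy
  rcases eq_or_ne x y with rfl | hne
  · simp only [sub_self, norm_zero]; positivity
  have hxy : 0 < ‖x - y‖ := norm_pos_iff.2 (sub_ne_zero.2 hne)
  obtain ⟨k1, k2⟩ := hk y x hne.symm
  unfold cauchyGreen
  rw [← mul_sub, ← integral_sub (disc_ker_int hu hx) (disc_ker_int hu hy), norm_mul, norm_neg,
    norm_inv, Complex.norm_real, Real.norm_of_nonneg hpi.le, mul_assoc]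
  gcongr
  have hae : ∀ z : ℂ, ∀ᵐ ω ∂(volume.restrict unitDisc), ω ≠ z := fun z =>
    ae_restrict_of_ae (Measure.ae_ne volume z)
  calc _ ≤ ∫ ω in unitDisc, M * 2 * ‖x - y‖ * (‖ω - y‖ ^ ((1 / 2 : ℝ) - 2) * ‖ω - x‖⁻¹) := by
        apply norm_integral_le_of_norm_le (k1.const_mul _).integrableOn
        filter_upwards [ae_restrict_mem Metric.isOpen_ball.measurableSet, hae x, hae y]
          with ω hω hωx hωy
        have h1 := sub_ne_zero.2 hωx
        have h2 := sub_ne_zero.2 hωy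
        have e : u ω / (ω - x) - u ω / (ω - y) = u ω * (x - y) * ((ω - y)⁻¹ * (ω - x)⁻¹) := by
          field_simp
          ring
        have hu' := hMb ω (Metric.ball_subset_closedBall hω)
        have h3 : 0 < ‖ω - y‖ := norm_pos_iff.2 h2
        have h4 : ‖ω - y‖ ≤ 2 := by
          have a1 : ‖ω‖ < 1 := by simpa [unitDisc] using hω
          have a2 : ‖y‖ ≤ 1 := by simpa using hy
          exact (norm_sub_le _ _).trans (by linarith)
        have h5 : ‖ω - y‖⁻¹ ≤ 2 * ‖ω - y‖ ^ ((1 / 2 : ℝ) - 2) := by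
          have e2 : ‖ω - y‖⁻¹ = ‖ω - y‖ ^ (1 / 2 : ℝ) * ‖ω - y‖ ^ ((1 / 2 : ℝ) - 2) := by
            rw [← Real.rpow_add h3, ← Real.rpow_neg_one]; norm_num
          rw [e2]
          gcongr
          calc ‖ω - y‖ ^ (1 / 2 : ℝ) ≤ 2 ^ (1 / 2 : ℝ) := by gcongr
            _ ≤ (2 : ℝ) ^ (1 : ℝ) := Real.rpow_le_rpow_of_exponent_le (by norm_num) (by norm_num)
            _ = 2 := Real.rpow_one 2
        rw [e, norm_mul, norm_mul, norm_mul, norm_inv, norm_inv]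
        calc _ ≤ M * ‖x - y‖ * (2 * ‖ω - y‖ ^ ((1 / 2 : ℝ) - 2) * ‖ω - x‖⁻¹) := by gcongr
          _ = _ := by ring
    _ ≤ ∫ ω, M * 2 * ‖x - y‖ * (‖ω - y‖ ^ ((1 / 2 : ℝ) - 2) * ‖ω - x‖⁻¹) := by
        apply setIntegral_le_integral (k1.const_mul _)
        exact Filter.Eventually.of_forall fun ω => by positivity
    _ ≤ _ := by
        rw [integral_const_mul]
        calc _ ≤ M * 2 * ‖x - y‖ * (C * ‖x - y‖ ^ ((1 / 2 : ℝ) - 1)) := by gcongr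
          _ = M * 2 * C * (‖x - y‖ ^ ((1 / 2 : ℝ) - 1) * ‖x - y‖) := by ring
          _ = _ := by
            rw [← Real.rpow_add_one hxy.ne']; norm_num

theorem circ_two {ω ζ : ℂ} (hω : ‖ω‖ < 1) (hζ : ‖ζ‖ < 1) (hne : ω ≠ ζ) (c : ℂ) :
    ∫ θ in Set.Ioc 0 (2 * π), circleMap 0 1 θ * Complex.I *
      (c / (ω - circleMap 0 1 θ) / (circleMap 0 1 θ - ζ)) = 0 := by
  have hpi := Real.pi_pos
  have h1 : ∮ η in C(0, 1), c / (ω - η) / (η - ζ) = 0 := by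
    have e : ∮ η in C(0, 1), c / (ω - η) / (η - ζ) =
        ∮ η in C(0, 1), (c / (ω - ζ)) * ((η - ζ)⁻¹ - (η - ω)⁻¹) := by
      apply circleIntegral.integral_congr zero_le_one
      intro η hη
      have hη' : ‖η‖ = 1 := by simpa using hη
      have a1 : ω - η ≠ 0 := by
        rw [sub_ne_zero]; rintro rfl; linarith
      have a2 : η - ζ ≠ 0 := by
        rw [sub_ne_zero]; rintro rfl; linarith
      have a3 : ω - ζ ≠ 0 := sub_ne_zero.2 hne
      have a4 : η - ω ≠ 0 := by rw [← neg_sub]; exact neg_ne_zero.2 a1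
      have : c / (ω - η) = - (c / (η - ω)) := by rw [← neg_sub η ω, div_neg]
      simp only [this]
      field_simp
      ring
    rw [e, circleIntegral.integral_const_mul, circleIntegral.integral_sub,
      circleIntegral.integral_sub_inv_of_mem_ball (by simpa using hζ),
      circleIntegral.integral_sub_inv_of_mem_ball (by simpa using hω), sub_self, mul_zero]
    · have := circ_div (h := fun _ => 1) continuous_const hζ 1
      simp only [pow_one, one_div] at this
      exact circ_integrable (h := fun η => (η - ζ)⁻¹) this
    · have := circ_div (h := fun _ => 1) continuous_const hω 1
      simp only [pow_one, one_div] at this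
      exact circ_integrable (h := fun η => (η - ω)⁻¹) this
  rw [circleIntegral, intervalIntegral.integral_of_le (by positivity)] at h1
  simpa only [deriv_circleMap, smul_eq_mul] using h1

theorem cint_cg {u : ℂ → ℂ} (hu : ContinuousOn u (Metric.closedBall 0 1)) {ζ : ℂ}
    (hζ : ‖ζ‖ < 1) : cint (cauchyGreen u) ζ = 0 := by
  have hpi := Real.pi_pos
  obtain ⟨M, hM, hMb⟩ := disc_bdd hu
  obtain ⟨K, hK⟩ := disc_inv
  set μ : Measure ℂ := volume.restrict unitDisc with hμ
  set ν : Measure ℝ := volume.restrict (Set.Ioc 0 (2 * π)) with hν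
  have : IsFiniteMeasure μ := by
    rw [hμ]; exact ⟨by simp [unitDisc]⟩
  have hmem : ∀ θ : ℝ, circleMap 0 1 θ ∈ Metric.closedBall (0 : ℂ) 1 := fun θ => by simp
  set f : ℝ × ℂ → ℂ := fun p => circleMap 0 1 p.1 * Complex.I *
      (u p.2 / (p.2 - circleMap 0 1 p.1) / (circleMap 0 1 p.1 - ζ)) with hf
  have hcm : Measurable (fun p : ℝ × ℂ => circleMap 0 1 p.1) :=
    (continuous_circleMap 0 1).measurable.comp measurable_fst
  have hfm : AEStronglyMeasurable f (ν.prod μ) := by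
    rw [hf]
    simp only [div_eq_mul_inv]
    refine AEStronglyMeasurable.mul ?_ (AEStronglyMeasurable.mul (AEStronglyMeasurable.mul ?_ ?_) ?_)
    · exact (hcm.mul measurable_const).aestronglyMeasurable
    · exact (disc_meas hu).comp_snd
    · exact (measurable_snd.sub hcm).inv.aestronglyMeasurable
    · exact (hcm.sub measurable_const).inv.aestronglyMeasurable
  have hfi : ∀ θ, Integrable (fun ω => f (θ, ω)) μ := by
    intro θ
    have := ((disc_ker_int hu (hmem θ)).div_const (circleMap 0 1 θ - ζ)).const_mul
      (circleMap 0 1 θ * Complex.I)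
    exact this
  have hfb : ∀ θ, ∫ ω, ‖f (θ, ω)‖ ∂μ ≤ M * (1 - ‖ζ‖)⁻¹ * K := by
    intro θ
    calc _ ≤ ∫ ω, M * (1 - ‖ζ‖)⁻¹ * ‖ω - circleMap 0 1 θ‖⁻¹ ∂μ := by
          apply integral_mono_ae (hfi θ).norm ((hK _ (hmem θ)).1.const_mul _)
          filter_upwards [ae_restrict_mem Metric.isOpen_ball.measurableSet] with ω hω
          have h1 := hMb ω (Metric.ball_subset_closedBall hω)
          have h2 := circ_dist hζ θ
          have h3 : 0 < 1 - ‖ζ‖ := by linarith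
          simp only [hf, norm_mul, norm_inv, norm_circleMap_zero, abs_one, Complex.norm_I, mul_one,
            one_mul, div_eq_mul_inv]
          calc _ ≤ M * ‖ω - circleMap 0 1 θ‖⁻¹ * (1 - ‖ζ‖)⁻¹ := by gcongr
            _ = _ := by ring
      _ ≤ _ := by
          rw [integral_const_mul]
          have h3 : 0 < 1 - ‖ζ‖ := by linarith
          gcongr
          exact (hK _ (hmem θ)).2
  have hint : Integrable f (ν.prod μ) := by
    rw [integrable_prod_iff hfm]
    refine ⟨Filter.Eventually.of_forall hfi, ?_⟩
    refine Integrable.mono' (integrable_const (M * (1 - ‖ζ‖)⁻¹ * K)) ?_ ?_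
    · exact hfm.norm.integral_prod_right'
    · refine Filter.Eventually.of_forall fun θ => ?_
      rw [Real.norm_of_nonneg (integral_nonneg fun ω => norm_nonneg _)]
      exact hfb θ
  have hsw : ∫ θ, ∫ ω, f (θ, ω) ∂μ ∂ν = 0 := by
    rw [integral_integral_swap (f := fun θ ω => f (θ, ω)) hint]
    rw [integral_eq_zero_of_ae]
    filter_upwards [ae_restrict_mem Metric.isOpen_ball.measurableSet,
      ae_restrict_of_ae (Measure.ae_ne volume ζ)] with ω hω hωζ
    exact circ_two (by simpa [unitDisc] using hω) hζ hωζ (u ω)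
  unfold cint
  rw [mul_eq_zero]; right
  rw [circleIntegral, intervalIntegral.integral_of_le (by positivity)]
  have e : ∀ θ : ℝ, deriv (circleMap 0 1) θ • (cauchyGreen u (circleMap 0 1 θ) /
      (circleMap 0 1 θ - ζ)) = -(π : ℂ)⁻¹ * ∫ ω, f (θ, ω) ∂μ := by
    intro θ
    simp only [hf, integral_const_mul, integral_div, cauchyGreen, deriv_circleMap, smul_eq_mul]
    ring
  simp only [e]
  rw [integral_const_mul, hsw, mul_zero]

theorem cint_rep {u W φ : ℂ → ℂ} (hu : ContinuousOn u (Metric.closedBall 0 1))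
    (hW : ContinuousOn W (Metric.closedBall 0 1)) (hφ : DifferentiableOn ℂ φ unitDisc)
    (h : ∀ ζ ∈ unitDisc, W ζ = cauchyGreen u ζ + φ ζ) {ζ : ℂ} (hζ : ‖ζ‖ < 1) :
    cint W ζ = φ ζ := by
  have hT := (holder_zero_iff.1 (cg_holder hu)).1
  have hφe : ∀ z ∈ unitDisc, W z - cauchyGreen u z = φ z := fun z hz => by
    rw [h z hz]; ring
  have hd : DiffContOnCl ℂ (fun z => W z - cauchyGreen u z) (Metric.ball 0 1) := by
    refine ⟨hφ.congr hφe, ?_⟩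
    rw [closure_ball _ one_ne_zero]
    exact hW.sub hT
  have hζ' : ζ ∈ Metric.ball (0 : ℂ) 1 := by simpa using hζ
  have h1 := hd.circleIntegral_sub_inv_smul hζ'
  rw [hφe ζ hζ'] at h1
  have h2 : cint (fun z => W z - cauchyGreen u z) ζ = φ ζ := by
    unfold cint
    have e : ∮ z in C(0, 1), (W z - cauchyGreen u z) / (z - ζ) =
        ∮ z in C(0, 1), (z - ζ)⁻¹ • (W z - cauchyGreen u z) := by
      simp only [smul_eq_mul, div_eq_inv_mul]
    rw [e, h1, smul_eq_mul, ← mul_assoc, inv_mul_cancel₀, one_mul]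
    simp [Real.pi_ne_zero]
  have h3 : cint (fun z => W z - cauchyGreen u z) ζ = cint W ζ - cint (cauchyGreen u) ζ := by
    unfold cint
    rw [← mul_sub, ← circleIntegral.integral_sub]
    · simp only [sub_div]
    · have := circ_div (circ_comp hW) hζ 1
      simp only [pow_one] at this
      exact circ_integrable (h := fun z => W z / (z - ζ)) this
    · have := circ_div (circ_comp hT) hζ 1
      simp only [pow_one] at this
      exact circ_integrable (h := fun z => cauchyGreen u z / (z - ζ)) this
  rw [← h2, h3, cint_cg hu hζ, sub_zero]

end Part9

/-- if `w ∈ C^α(D̄,ℂⁿ)` satisfies `w = T(B₁w + B₂w̄) + φ` on `D` with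
`B₁, B₂ ∈ C^{k-1,α}` and `φ` holomorphic on `D`, and `w` is of class `C^{k,α}` on the
annulus `D̄ \ D_{1/2}`, then `φ` extends to a function of class `C^{k,α}(D̄)` and
consequently `w ∈ C^{k,α}(D̄,ℂⁿ)`. -/
theorem stmt18 (n : ℕ) (k : ℕ) (hk : 1 ≤ k) (α : ℝ) (hα₀ : 0 < α) (hα₁ : α < 1)
    (B₁ B₂ : ℂ → Matrix (Fin n) (Fin n) ℂ)
    (hB₁ : ∀ i j, HolderOn (k - 1) α (closure unitDisc) (fun ζ => B₁ ζ i j))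
    (hB₂ : ∀ i j, HolderOn (k - 1) α (closure unitDisc) (fun ζ => B₂ ζ i j))
    (w φ : ℂ → (Fin n → ℂ))
    (hw : HolderOn 0 α (closure unitDisc) w)
    (hφ : DifferentiableOn ℂ φ unitDisc)
    (heq : ∀ ζ ∈ unitDisc,
      w ζ = cauchyGreenV (fun ω => B₁ ω *ᵥ w ω + B₂ ω *ᵥ vecConj (w ω)) ζ + φ ζ)
    (hann : HolderOn k α (closure unitDisc \ Metric.ball (0 : ℂ) (1 / 2)) w) :
    (∃ φext : ℂ → (Fin n → ℂ), (∀ ζ ∈ unitDisc, φext ζ = φ ζ) ∧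
      HolderOn k α (closure unitDisc) φext) ∧
    HolderOn k α (closure unitDisc) w := by
  have hcl : closure unitDisc = Metric.closedBall (0 : ℂ) 1 := closure_ball _ one_ne_zero
  simp only [hcl] at hB₁ hB₂ hw hann ⊢
  have hs := uniq_closedBall one_pos (0 : ℂ)
  have hi := interior_reg hα₀ hα₁ hB₁ hB₂ hw hφ heq k le_rfl (3 / 4) (by norm_num) (by norm_num)
  have hwk : HolderOn k α (Metric.closedBall 0 1) w := w_reg hα₀ hi hann
  refine ⟨?_, hwk⟩
  have hwj := (holder_pi hs).1 hwk
  choose G hG hGh using fun j => privalov hα₀ hα₁ (hwj j)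
  have hu := fun j => (rhs_holder hα₀ hα₁ one_pos
      (fun i j => holder_lower hα₀ hα₁ one_pos (Nat.zero_le _) (hB₁ i j))
      (fun i j => holder_lower hα₀ hα₁ one_pos (Nat.zero_le _) (hB₂ i j)) hw j).1.continuousOn
  refine ⟨fun ζ j => G j ζ, fun ζ hζ => ?_, (holder_pi hs).2 hGh⟩
  have hζ' : ‖ζ‖ < 1 := by simpa [unitDisc] using hζ
  ext j
  change G j ζ = φ ζ j
  rw [hG j ζ hζ']
  refine cint_rep (u := fun ω => (B₁ ω *ᵥ w ω + B₂ ω *ᵥ vecConj (w ω)) j)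
    (φ := fun z => φ z j) (hu j) (hwj j).1.continuousOn
    (fun z hz => ((differentiableWithinAt_pi.1 (hφ z hz)) j)) ?_ hζ'
  intro z hz
  rw [heq z hz]
  rfl
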